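/- arXiv:2104.01134 — 2 statements merged into one kernel-verified Lean document; each statement's English description precedes it below -/
import Mathlib

section
/- Let $n \geq 2$ and let $X_n$ be the number of crossings in a uniformly random chord diagram of size $n$. Let $W_n = (X_n - \mu_n)/\sigma_n$ where $\mu_n = E X_n$ and $\sigma_n^2 = \mathrm{Var}(X_n)$, and let $Z$ be a standard normal random variable. Then the Kolmogorov distance satisfies $d_K(W_n, Z) \leq 12920\, n^{-1/2}$; in particular $d_K(W_n,Z) = O(n^{-1/2})$. -/
open MeasureTheory ProbabilityTheory Filter
open scoped Nat

instance {N : ℕ} : MeasurableSpace (Equiv.Perm (Fin N)) := ⊤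

/-- A chord diagram of size `n` is a fixed-point-free involution of `{1,…,2n}`. -/
def IsChordDiagram {n : ℕ} (π : Equiv.Perm (Fin (2 * n))) : Prop :=
  (∀ i, π (π i) = i) ∧ ∀ i, π i ≠ i

/-- The uniform probability measure on chord diagrams of size `n`. -/
noncomputable def uniformCD (n : ℕ) : Measure (Equiv.Perm (Fin (2 * n))) :=
  uniformOn {π | IsChordDiagram π}

/-- The number of crossings: quadruples `i < j < k < l` with `π i = k` and `π j = l`. -/
def crossings {n : ℕ} (π : Equiv.Perm (Fin (2 * n))) : ℕ :=
  ((Finset.univ : Finset (Fin (2 * n) × Fin (2 * n) × Fin (2 * n) × Fin (2 * n))).filter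
    (fun q => q.1 < q.2.1 ∧ q.2.1 < q.2.2.1 ∧ q.2.2.1 < q.2.2.2 ∧
      π q.1 = q.2.2.1 ∧ π q.2.1 = q.2.2.2)).card

/-- The number of simple chords: indices `k` with `π k = k + 1 (mod 2n)`. -/
def simpleChords {n : ℕ} (π : Equiv.Perm (Fin (2 * n))) : ℕ :=
  (Finset.univ.filter (fun k => π k = finRotate (2 * n) k)).card

/-! ### The Stein equation -/

lemma integrable_exp_neg_half_sq : Integrable (fun x : ℝ => Real.exp (-(1 / 2) * x ^ 2)) :=
  integrable_exp_neg_mul_sq (by norm_num)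

lemma hasDerivAt_exp_neg_half_sq (x : ℝ) :
    HasDerivAt (fun x : ℝ => Real.exp (-(1 / 2) * x ^ 2))
      (-x * Real.exp (-(1 / 2) * x ^ 2)) x := by
  have := (((hasDerivAt_id x).pow 2).const_mul (-(1 / 2 : ℝ))).exp
  simp only [id, Pi.pow_apply] at this
  convert this using 1
  simp
  ring

lemma mul_gaussian_tail_le (w : ℝ) :
    w * ∫ x in Set.Ioi w, Real.exp (-(1 / 2) * x ^ 2) ≤ Real.exp (-(1 / 2) * w ^ 2) := by
  have hInt : IntegrableOn (fun x : ℝ => x * Real.exp (-(1 / 2) * x ^ 2)) (Set.Ioi w) :=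
    (integrable_mul_exp_neg_mul_sq (by norm_num)).integrableOn
  have hlim : Tendsto (fun x : ℝ => -Real.exp (-(1 / 2) * x ^ 2)) atTop (nhds (-0)) := by
    refine Tendsto.neg (Real.tendsto_exp_atBot.comp ?_)
    exact Tendsto.const_mul_atTop_of_neg (by norm_num) (tendsto_pow_atTop (by norm_num))
  have h := integral_Ioi_of_hasDerivAt_of_tendsto'
    (f := fun x : ℝ => -Real.exp (-(1 / 2) * x ^ 2))
    (f' := fun x : ℝ => x * Real.exp (-(1 / 2) * x ^ 2)) (a := w)
    (fun x _ => (hasDerivAt_exp_neg_half_sq x).neg.congr_deriv (by ring)) hInt hlim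
  rw [← integral_const_mul]
  calc _ ≤ ∫ x in Set.Ioi w, x * Real.exp (-(1 / 2) * x ^ 2) := by
        refine setIntegral_mono_on (integrable_exp_neg_half_sq.const_mul w).integrableOn hInt
          measurableSet_Ioi fun x hx => ?_
        exact mul_le_mul_of_nonneg_right (le_of_lt hx) (Real.exp_pos _).le
    _ = _ := by rw [h]; simp

lemma gaussian_tail_le {w : ℝ} (hw : 0 ≤ w) :
    ∫ x in Set.Ioi w, Real.exp (-(1 / 2) * x ^ 2) ≤ 3 / 2 * Real.exp (-(1 / 2) * w ^ 2) := by
  have h1 : ∫ x in Set.Ioi w, Real.exp (-(1 / 2) * x ^ 2) =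
      ∫ x in Set.Ioi (0 : ℝ), Real.exp (-(1 / 2) * (x + w) ^ 2) := by
    have := (measurePreserving_add_right volume w).setIntegral_preimage_emb
      (MeasurableEquiv.addRight w).measurableEmbedding
      (fun x : ℝ => Real.exp (-(1 / 2) * x ^ 2)) (Set.Ioi w)
    rw [← this]
    congr 2
    ext x
    simp
  have h2 : ∫ x in Set.Ioi (0 : ℝ), Real.exp (-(1 / 2) * x ^ 2) ≤ 3 / 2 := by
    rw [integral_gaussian_Ioi, div_le_iff₀ (by norm_num), Real.sqrt_le_left (by norm_num)]
    have := Real.pi_lt_d2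
    norm_num
    linarith
  have hInt : Integrable (fun x : ℝ => Real.exp (-(1 / 2) * (x + w) ^ 2)) :=
    integrable_exp_neg_half_sq.comp_add_right w
  rw [h1]
  calc _ ≤ ∫ x in Set.Ioi (0 : ℝ), Real.exp (-(1 / 2) * w ^ 2) * Real.exp (-(1 / 2) * x ^ 2) := by
        refine setIntegral_mono_on hInt.integrableOn
          (integrable_exp_neg_half_sq.const_mul _).integrableOn measurableSet_Ioi fun x hx => ?_
        rw [← Real.exp_add]
        refine Real.exp_le_exp.2 ?_
        nlinarith [mul_nonneg (le_of_lt hx : (0 : ℝ) ≤ x) hw]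
    _ ≤ _ := by
        rw [integral_const_mul, mul_comm]
        exact mul_le_mul_of_nonneg_right h2 (Real.exp_pos _).le

lemma abs_setIntegral_mul_gaussian_le {g : ℝ → ℝ} (hg1 : ∀ x, |g x| ≤ 1)
    (s : Set ℝ) :
    |∫ x in s, g x * Real.exp (-(1 / 2) * x ^ 2)| ≤ ∫ x in s, Real.exp (-(1 / 2) * x ^ 2) := by
  rw [← Real.norm_eq_abs]
  refine norm_integral_le_of_norm_le integrable_exp_neg_half_sq.integrableOn
    (Eventually.of_forall fun x => ?_)
  rw [Real.norm_eq_abs, abs_mul, abs_of_pos (Real.exp_pos _)]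
  exact mul_le_of_le_one_left (Real.exp_pos _).le (hg1 x)

/-- For a centered continuous `g` bounded by `1`, the Stein equation `f' - w f = g` has a solution
bounded by `3 / 2` with `|w f| ≤ 1`. -/
lemma exists_stein_solution_of_centered {g : ℝ → ℝ} (hg : Continuous g) (hg1 : ∀ x, |g x| ≤ 1)
    (hg0 : ∫ x, g x * Real.exp (-(1 / 2) * x ^ 2) = 0) :
    ∃ f : ℝ → ℝ, (∀ w, HasDerivAt f (w * f w + g w) w) ∧ (∀ w, |f w| ≤ 3 / 2) ∧
      ∀ w, |w * f w| ≤ 1 := by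
  set e : ℝ → ℝ := fun x => Real.exp (-(1 / 2) * x ^ 2) with he
  have hInt : Integrable (fun x => g x * e x) :=
    integrable_exp_neg_half_sq.bdd_mul (c := 1) hg.aestronglyMeasurable
      (Eventually.of_forall fun x => by simpa using hg1 x)
  set F : ℝ → ℝ := fun w => ∫ x in Set.Iic w, g x * e x with hF
  have hcont : Continuous (fun x => g x * e x) := by
    have : Continuous e := by fun_prop
    fun_prop
  have hderiv : ∀ w, HasDerivAt F (g w * e w) w := by
    intro w
    have h1 : F = fun w => (∫ x in Set.Iic 0, g x * e x) + ∫ x in (0 : ℝ)..w, g x * e x := by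
      ext w
      rw [← intervalIntegral.integral_Iic_sub_Iic hInt.integrableOn hInt.integrableOn]
      simp [hF]
    rw [h1]
    exact (intervalIntegral.integral_hasDerivAt_right (hcont.intervalIntegrable _ _)
      hcont.stronglyMeasurable.stronglyMeasurableAtFilter hcont.continuousAt).const_add _
  have hFneg : ∀ w, F w = -∫ x in Set.Ioi w, g x * e x := by
    intro w
    have := integral_add_compl (measurableSet_Iic (a := w)) hInt
    rw [Set.compl_Iic, hg0] at this
    simp only [hF]
    linarith
  have hrefl : ∀ w, ∫ x in Set.Iic w, e x = ∫ x in Set.Ioi (-w), e x := by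
    intro w
    rw [← integral_comp_neg_Iic]
    simp [he]
  have hb : ∀ w, |F w| ≤ ∫ x in Set.Ioi |w|, e x := by
    intro w
    rcases le_total 0 w with hw | hw
    · rw [hFneg, abs_neg, abs_of_nonneg hw]
      exact abs_setIntegral_mul_gaussian_le hg1 _
    · rw [abs_of_nonpos hw, ← hrefl]
      exact abs_setIntegral_mul_gaussian_le hg1 _
  have hpos : ∀ w, 0 < e w := fun w => Real.exp_pos _
  have habs : ∀ w, e |w| = e w := fun w => by simp [he]
  refine ⟨fun w => F w / e w, fun w => ?_, fun w => ?_, fun w => ?_⟩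
  · refine ((hderiv w).div (hasDerivAt_exp_neg_half_sq w) (hpos w).ne').congr_deriv ?_
    have := (hpos w).ne'
    change (g w * e w * e w - F w * (-w * e w)) / e w ^ 2 = w * (F w / e w) + g w
    field_simp
    ring
  · rw [abs_div, abs_of_pos (hpos w), div_le_iff₀ (hpos w), ← habs]
    exact (hb w).trans (gaussian_tail_le (abs_nonneg w))
  · rw [abs_mul, abs_div, abs_of_pos (hpos w), ← mul_div_assoc, div_le_iff₀ (hpos w), ← habs,
      one_mul]
    exact (mul_le_mul_of_nonneg_left (hb w) (abs_nonneg w)).trans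
      (mul_gaussian_tail_le |w|)

lemma exists_stein_solution {h : ℝ → ℝ} (hc : Continuous h) (h0 : ∀ x, 0 ≤ h x)
    (h1 : ∀ x, h x ≤ 1) :
    ∃ f : ℝ → ℝ, (∀ w, HasDerivAt f (w * f w + (h w - ∫ x, h x ∂gaussianReal 0 1)) w) ∧
      (∀ w, |f w| ≤ 3 / 2) ∧ ∀ w, |w * f w + (h w - ∫ x, h x ∂gaussianReal 0 1)| ≤ 2 := by
  set m := ∫ x, h x ∂gaussianReal 0 1 with hm
  have hInt : Integrable h (gaussianReal 0 1) :=
    Integrable.of_bound hc.aestronglyMeasurable 1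
      (Eventually.of_forall fun x => by simpa [abs_of_nonneg (h0 x)] using h1 x)
  have hm0 : 0 ≤ m := integral_nonneg h0
  have hm1 : m ≤ 1 := by
    simpa using integral_mono hInt (integrable_const (1 : ℝ)) h1
  have hb : ∀ x, |h x - m| ≤ 1 := fun x => by
    rw [abs_le]; constructor <;> linarith [h0 x, h1 x]
  have hz : ∫ x, (h x - m) * Real.exp (-(1 / 2) * x ^ 2) = 0 := by
    have h2 : ∫ x, (h x - m) ∂gaussianReal 0 1 = 0 := by
      rw [integral_sub hInt (integrable_const _)]
      simp [hm]
    rw [integral_gaussianReal_eq_integral_smul one_ne_zero] at h2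
    have h3 : ∀ x, gaussianPDFReal 0 1 x • (h x - m) =
        (√(2 * Real.pi))⁻¹ * ((h x - m) * Real.exp (-(1 / 2) * x ^ 2)) := fun x => by
      simp only [gaussianPDFReal, smul_eq_mul, NNReal.coe_one, mul_one, sub_zero]
      rw [show -x ^ 2 / 2 = -(1 / 2) * x ^ 2 by ring]
      ring
    simp_rw [h3, integral_const_mul] at h2
    refine (mul_eq_zero.1 h2).resolve_left ?_
    have := Real.pi_pos
    positivity
  obtain ⟨f, hf, hf1, hf2⟩ := exists_stein_solution_of_centered (hc.sub continuous_const) hb hz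
  refine ⟨f, hf, hf1, fun w => ?_⟩
  calc _ ≤ |w * f w| + |h w - m| := abs_add_le _ _
    _ ≤ 2 := by linarith [hf2 w, hb w]

/-- Intervals of length `l` have standard Gaussian measure at most `l / 2`. -/
lemma gaussianReal_cdf_sub_le {a b : ℝ} (hab : a ≤ b) :
    (gaussianReal 0 1).real (Set.Iic b) ≤ (gaussianReal 0 1).real (Set.Iic a) + (b - a) / 2 := by
  have h1 : (gaussianReal 0 1).real (Set.Ioc a b) ≤ (b - a) / 2 := by
    rw [measureReal_def, gaussianReal_apply_eq_integral _ one_ne_zero,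
      ENNReal.toReal_ofReal (integral_nonneg fun x => gaussianPDFReal_nonneg _ _ _)]
    calc _ ≤ ∫ x in Set.Ioc a b, (1 / 2 : ℝ) := by
          refine setIntegral_mono (integrable_gaussianPDFReal 0 1).integrableOn
            (integrableOn_const (by simp)) fun x => ?_
          simp only [gaussianPDFReal, NNReal.coe_one, mul_one]
          have h2 : (2 : ℝ) ≤ √(2 * Real.pi) := by
            refine Real.le_sqrt_of_sq_le ?_
            linarith [Real.pi_gt_three]
          have h3 : Real.exp (-(x - 0) ^ 2 / 2) ≤ 1 := Real.exp_le_one_iff.2 (by nlinarith [sq_nonneg x])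
          calc _ ≤ (√(2 * Real.pi))⁻¹ * 1 := by gcongr
            _ ≤ _ := by rw [mul_one, one_div]; gcongr
      _ = _ := by simp [hab]; ring
  have h2 : Set.Iic b = Set.Iic a ∪ Set.Ioc a b := (Set.Iic_union_Ioc_eq_Iic hab).symm
  rw [h2]
  exact (measureReal_union_le _ _).trans (by linarith)

/-! ### Normal approximation for locally dependent sums -/

lemma abs_sub_sub_mul_le_of_deriv_osc {f f' : ℝ → ℝ} (hf : ∀ w, HasDerivAt f (f' w) w)
    {w δ β C : ℝ} (hδ : |δ| ≤ β) (hC : ∀ θ, |θ - w| ≤ β → |f' θ - f' w| ≤ C) :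
    |f w - f (w - δ) - δ * f' w| ≤ β * C := by
  have hβ : 0 ≤ β := (abs_nonneg δ).trans hδ
  have hd : ∀ x ∈ Metric.closedBall w β,
      HasDerivWithinAt (fun x => f x - x * f' w) (f' x - f' w) (Metric.closedBall w β) x :=
    fun x _ => (((hf x).sub ((hasDerivAt_id x).mul_const (f' w))).congr_deriv
      (by rw [one_mul])).hasDerivWithinAt
  have h := (convex_closedBall w β).norm_image_sub_le_of_norm_hasDerivWithin_le hd (C := C)
    (fun x hx => hC x (by simpa [Real.dist_eq] using hx))
    (x := w - δ) (y := w) (by simpa [Real.dist_eq] using hδ) (by simpa using hβ)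
  have h2 : ‖w - (w - δ)‖ ≤ β := by simpa using hδ
  have hC0 : 0 ≤ C := (abs_nonneg _).trans (hC w (by simpa using hβ))
  calc _ = ‖f w - w * f' w - (f (w - δ) - (w - δ) * f' w)‖ := by
        rw [Real.norm_eq_abs]; congr 1; ring
    _ ≤ C * ‖w - (w - δ)‖ := h
    _ ≤ _ := by rw [mul_comm]; gcongr

lemma stein_deriv_osc {f h : ℝ → ℝ} {c : ℝ} (hf : ∀ w, HasDerivAt f (w * f w + (h w - c)) w)
    (hf1 : ∀ w, |f w| ≤ 3 / 2) (hf2 : ∀ w, |w * f w + (h w - c)| ≤ 2) {θ w β : ℝ}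
    (hθ : |θ - w| ≤ β) :
    |θ * f θ + (h θ - c) - (w * f w + (h w - c))| ≤
      β * (3 / 2) + |w| * (2 * β) + |h θ - h w| := by
  have hβ : 0 ≤ β := (abs_nonneg _).trans hθ
  have h1 : |f θ - f w| ≤ 2 * β := by
    have := Convex.norm_image_sub_le_of_norm_hasDerivWithin_le (𝕜 := ℝ) (s := Set.univ) (C := 2)
      (fun x _ => (hf x).hasDerivWithinAt) (fun x _ => hf2 x) convex_univ
      (Set.mem_univ w) (Set.mem_univ θ)
    calc _ ≤ 2 * |θ - w| := this
      _ ≤ _ := by gcongr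
  calc _ = |(θ - w) * f θ + w * (f θ - f w) + (h θ - h w)| := by congr 1; ring
    _ ≤ |(θ - w) * f θ| + |w * (f θ - f w)| + |h θ - h w| := abs_add_three _ _ _
    _ ≤ _ := by
        rw [abs_mul, abs_mul]
        gcongr
        exact hf1 θ

/-- Continuous approximation of the indicator of `(-∞, z]`, linear on `[z, z + ε]`. -/
noncomputable def smoothStep (z ε x : ℝ) : ℝ := max 0 (min 1 ((z + ε - x) / ε))

lemma continuous_smoothStep (z ε : ℝ) : Continuous (smoothStep z ε) := by
  unfold smoothStep
  fun_prop

lemma smoothStep_nonneg (z ε x : ℝ) : 0 ≤ smoothStep z ε x := le_max_left _ _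

lemma smoothStep_le_one (z ε x : ℝ) : smoothStep z ε x ≤ 1 :=
  max_le zero_le_one (min_le_left _ _)

lemma smoothStep_of_le {z ε x : ℝ} (hε : 0 < ε) (hx : x ≤ z) : smoothStep z ε x = 1 := by
  have : 1 ≤ (z + ε - x) / ε := by rw [le_div_iff₀ hε]; linarith
  simp [smoothStep, this]

lemma smoothStep_of_ge {z ε x : ℝ} (hε : 0 < ε) (hx : z + ε ≤ x) : smoothStep z ε x = 0 := by
  have : (z + ε - x) / ε ≤ 0 := div_nonpos_of_nonpos_of_nonneg (by linarith) hε.le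
  simp only [smoothStep, max_eq_left_iff]
  exact (min_le_right _ _).trans this

lemma abs_smoothStep_sub_le {z ε : ℝ} (hε : 0 < ε) (x y : ℝ) :
    |smoothStep z ε x - smoothStep z ε y| ≤ |x - y| / ε := by
  have h1 : |smoothStep z ε x - smoothStep z ε y| ≤
      |min 1 ((z + ε - x) / ε) - min 1 ((z + ε - y) / ε)| := by
    refine (abs_max_sub_max_le_max _ _ _ _).trans ?_
    simp
  have h2 : |min 1 ((z + ε - x) / ε) - min 1 ((z + ε - y) / ε)| ≤
      |(z + ε - x) / ε - (z + ε - y) / ε| := by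
    refine (abs_min_sub_min_le_max _ _ _ _).trans ?_
    simp
  refine h1.trans (h2.trans_eq ?_)
  rw [← sub_div, abs_div, abs_of_pos hε, abs_sub_comm]
  congr 2
  ring

lemma abs_smoothStep_sub_le_indicator {z ε β θ w : ℝ} (hε : 0 < ε) (h : |θ - w| ≤ β) :
    |smoothStep z ε θ - smoothStep z ε w| ≤
      (Set.Icc (z - β) (z + ε + β)).indicator (fun _ => β / ε) w := by
  have ha := abs_le.1 h
  by_cases hw : w ∈ Set.Icc (z - β) (z + ε + β)
  · rw [Set.indicator_of_mem hw]
    exact (abs_smoothStep_sub_le hε _ _).trans (by gcongr)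
  · rw [Set.indicator_of_notMem hw]
    rw [Set.mem_Icc, not_and_or, not_le, not_le] at hw
    have hβ : 0 ≤ β := (abs_nonneg _).trans h
    rcases hw with hw | hw
    · rw [smoothStep_of_le hε (by linarith), smoothStep_of_le hε (by linarith)]; simp
    · rw [smoothStep_of_ge hε (by linarith), smoothStep_of_ge hε (by linarith)]; simp

lemma indicator_le_smoothStep {z ε : ℝ} (hε : 0 < ε) (x : ℝ) :
    (Set.Iic z).indicator (fun _ => (1 : ℝ)) x ≤ smoothStep z ε x := by
  by_cases hx : x ≤ z
  · simp [hx, smoothStep_of_le hε hx]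
  · simpa [hx] using smoothStep_nonneg z ε x

lemma smoothStep_le_indicator {z ε : ℝ} (hε : 0 < ε) (x : ℝ) :
    smoothStep z ε x ≤ (Set.Iic (z + ε)).indicator (fun _ => (1 : ℝ)) x := by
  by_cases hx : x ≤ z + ε
  · simpa [hx] using smoothStep_le_one z ε x
  · simp [hx, smoothStep_of_ge hε (not_le.1 hx).le]

lemma cdf_le_integral_smoothStep {ν : Measure ℝ} [IsProbabilityMeasure ν] {z ε : ℝ} (hε : 0 < ε) :
    ν.real (Set.Iic z) ≤ ∫ x, smoothStep z ε x ∂ν := by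
  rw [← integral_indicator_one measurableSet_Iic]
  refine integral_mono ((integrable_const 1).indicator measurableSet_Iic) ?_
    (indicator_le_smoothStep hε)
  exact Integrable.of_bound (continuous_smoothStep z ε).aestronglyMeasurable 1
    (Eventually.of_forall fun x => by
      simpa [abs_of_nonneg (smoothStep_nonneg z ε x)] using smoothStep_le_one z ε x)

lemma integral_smoothStep_le_cdf {ν : Measure ℝ} [IsProbabilityMeasure ν] {z ε : ℝ} (hε : 0 < ε) :
    ∫ x, smoothStep z ε x ∂ν ≤ ν.real (Set.Iic (z + ε)) := by
  rw [← integral_indicator_one measurableSet_Iic]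
  refine integral_mono ?_ ((integrable_const 1).indicator measurableSet_Iic)
    (smoothStep_le_indicator hε)
  exact Integrable.of_bound (continuous_smoothStep z ε).aestronglyMeasurable 1
    (Eventually.of_forall fun x => by
      simpa [abs_of_nonneg (smoothStep_nonneg z ε x)] using smoothStep_le_one z ε x)

lemma sum_compl_eq_sub {E : Type*} [Fintype E] [DecidableEq E] (s : Finset E) (x : E → ℝ) :
    ∑ g ∈ sᶜ, x g = ∑ g, x g - ∑ g ∈ s, x g := by
  rw [← Finset.sum_add_sum_compl s]
  ring

/-- A normalized family of centered bounded random variables whose dependence is local: each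
neighborhood `nbr e` has at most `d` elements, `ξ e` is independent of the sum over the complement
of `nbr e`, and products over non-adjacent pairs of indices are independent. -/
structure LocallyDependent {Ω E : Type*} [MeasurableSpace Ω] [Fintype E] [DecidableEq E]
    (P : Measure Ω) (nbr : E → Finset E) (ξ : E → Ω → ℝ) (a : ℝ) (d : ℕ) : Prop where
  measurable : ∀ e, Measurable (ξ e)
  bound : ∀ e ω, |ξ e ω| ≤ a
  mean_zero : ∀ e, ∫ ω, ξ e ω ∂P = 0
  second_moment : ∫ ω, (∑ e, ξ e ω) ^ 2 ∂P = 1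
  card_nbr : ∀ e, (nbr e).card ≤ d
  symm : ∀ e g, g ∈ nbr e → e ∈ nbr g
  indep_sum : ∀ e, IndepFun (ξ e) (fun ω => ∑ g ∈ (nbr e)ᶜ, ξ g ω) P
  indep_mul : ∀ e g e' g', e' ∉ nbr e ∪ nbr g → g' ∉ nbr e ∪ nbr g →
    IndepFun (fun ω => ξ e ω * ξ g ω) (fun ω => ξ e' ω * ξ g' ω) P

namespace LocallyDependent

variable {Ω E : Type*} [MeasurableSpace Ω] [Fintype E] [DecidableEq E]
  {P : Measure Ω} {nbr : E → Finset E} {ξ : E → Ω → ℝ} {a : ℝ} {d : ℕ}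

lemma abs_nbr_sum_le (h : LocallyDependent P nbr ξ a d) (ha : 0 ≤ a) (e : E) (ω : Ω) :
    |∑ g ∈ nbr e, ξ g ω| ≤ d * a := by
  calc _ ≤ ∑ g ∈ nbr e, |ξ g ω| := Finset.abs_sum_le_sum_abs _ _
    _ ≤ (nbr e).card • a := Finset.sum_le_card_nsmul _ _ _ fun g _ => h.bound g ω
    _ ≤ _ := by
        rw [nsmul_eq_mul]
        have : ((nbr e).card : ℝ) ≤ d := by exact_mod_cast h.card_nbr e
        gcongr

lemma abs_sum_le (h : LocallyDependent P nbr ξ a d) (s : Finset E) (ω : Ω) :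
    |∑ g ∈ s, ξ g ω| ≤ s.card * a := by
  calc _ ≤ ∑ g ∈ s, |ξ g ω| := Finset.abs_sum_le_sum_abs _ _
    _ ≤ s.card • a := Finset.sum_le_card_nsmul _ _ _ fun g _ => h.bound g ω
    _ = _ := nsmul_eq_mul _ _

lemma measurable_sum (h : LocallyDependent P nbr ξ a d) (s : Finset E) :
    Measurable (fun ω => ∑ g ∈ s, ξ g ω) :=
  Finset.measurable_fun_sum _ fun g _ => h.measurable g

lemma integral_mul_comp_compl_eq_zero (h : LocallyDependent P nbr ξ a d) {f : ℝ → ℝ}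
    (hf : Measurable f) (e : E) : ∫ ω, ξ e ω * f (∑ g ∈ (nbr e)ᶜ, ξ g ω) ∂P = 0 := by
  have hi : IndepFun (ξ e) (fun ω => f (∑ g ∈ (nbr e)ᶜ, ξ g ω)) P :=
    (h.indep_sum e).comp measurable_id hf
  rw [hi.integral_fun_mul_eq_mul_integral (h.measurable e).aestronglyMeasurable
    (hf.comp (h.measurable_sum _)).aestronglyMeasurable, h.mean_zero, zero_mul]

variable [IsProbabilityMeasure P]

lemma integrable_sum (h : LocallyDependent P nbr ξ a d) (s : Finset E) :
    Integrable (fun ω => ∑ g ∈ s, ξ g ω) P :=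
  Integrable.of_bound (h.measurable_sum s).aestronglyMeasurable _
    (Eventually.of_forall fun ω => h.abs_sum_le s ω)

lemma integral_abs_sum_le_one (h : LocallyDependent P nbr ξ a d) :
    ∫ ω, |∑ e, ξ e ω| ∂P ≤ 1 := by
  have h2 : Integrable (fun ω => (∑ e, ξ e ω) ^ 2) P := by
    by_contra hn
    have := h.second_moment
    rw [integral_undef hn] at this
    norm_num at this
  have h3 : ∫ ω, |∑ e, ξ e ω| ∂P ≤ ∫ ω, ((∑ e, ξ e ω) ^ 2 + 1) / 2 ∂P := by
    refine integral_mono (h.integrable_sum _).abs ((h2.add (integrable_const 1)).div_const 2)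
      fun ω => ?_
    change |∑ e, ξ e ω| ≤ ((∑ e, ξ e ω) ^ 2 + 1) / 2
    nlinarith [sq_abs (∑ e, ξ e ω), sq_nonneg (|∑ e, ξ e ω| - 1)]
  refine h3.trans_eq ?_
  rw [integral_div, integral_add h2 (integrable_const 1), h.second_moment]
  simp

lemma integral_sum_mul_nbr_sum (h : LocallyDependent P nbr ξ a d) :
    ∫ ω, ∑ e, ξ e ω * ∑ g ∈ nbr e, ξ g ω ∂P = 1 := by
  have hInt : ∀ e (s : Finset E), Integrable (fun ω => ξ e ω * ∑ g ∈ s, ξ g ω) P := fun e s =>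
    (h.integrable_sum s).bdd_mul (h.measurable e).aestronglyMeasurable
      (Eventually.of_forall fun ω => h.bound e ω)
  have hint2 : ∀ e, Integrable (fun ω => ξ e ω * (∑ g ∈ nbr e, ξ g ω) +
      ξ e ω * ∑ g ∈ (nbr e)ᶜ, ξ g ω) P := fun e => (hInt e _).add (hInt e _)
  rw [← h.second_moment]
  have h1 : ∀ ω, (∑ e, ξ e ω) ^ 2 = ∑ e, (ξ e ω * (∑ g ∈ nbr e, ξ g ω) +
      ξ e ω * ∑ g ∈ (nbr e)ᶜ, ξ g ω) := fun ω => by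
    rw [sq, Finset.sum_mul]
    refine Finset.sum_congr rfl fun e _ => ?_
    rw [← mul_add, Finset.sum_add_sum_compl]
  simp_rw [h1]
  rw [integral_finsetSum _ fun e _ => hInt e _,
    integral_finsetSum _ fun e _ => hint2 e]
  refine Finset.sum_congr rfl fun e _ => ?_
  have h2 : ∫ ω, ξ e ω * ∑ g ∈ (nbr e)ᶜ, ξ g ω ∂P = 0 :=
    h.integral_mul_comp_compl_eq_zero measurable_id e
  rw [integral_add (hInt e _) (hInt e _), h2, add_zero]

/-- The bound of Stein's method for a continuous test function `g` with values in `[0, 1]`, whose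
oscillation on balls of radius `d a` is controlled by `q`. -/
lemma abs_integral_comp_sub_le (h : LocallyDependent P nbr ξ a d) (ha : 0 ≤ a) {g q : ℝ → ℝ}
    (hg : Continuous g) (hg0 : ∀ x, 0 ≤ g x) (hg1 : ∀ x, g x ≤ 1) (hq : Measurable q)
    {Q : ℝ} (hqQ : ∀ x, |q x| ≤ Q)
    (hosc : ∀ θ w, |θ - w| ≤ d * a → |g θ - g w| ≤ q w) :
    |∫ ω, g (∑ e, ξ e ω) ∂P - ∫ x, g x ∂gaussianReal 0 1| ≤
      2 * ∫ ω, |1 - ∑ e, ξ e ω * ∑ g ∈ nbr e, ξ g ω| ∂P +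
      Fintype.card E * a * (d * a) * (7 / 2 * (d * a) + ∫ ω, q (∑ e, ξ e ω) ∂P) := by
  obtain ⟨f, hf, hf1, hf2⟩ := exists_stein_solution hg hg0 hg1
  set c := ∫ x, g x ∂gaussianReal 0 1
  set f' : ℝ → ℝ := fun w => w * f w + (g w - c) with hf'
  set W : Ω → ℝ := fun ω => ∑ e, ξ e ω with hW
  set D : E → Ω → ℝ := fun e ω => ∑ g ∈ nbr e, ξ g ω with hD
  set K : Ω → ℝ := fun ω => ∑ e, ξ e ω * D e ω with hK
  set β : ℝ := d * a with hβdef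
  have hβ : 0 ≤ β := by positivity
  have hfc : Continuous f := continuous_iff_continuousAt.2 fun w => (hf w).continuousAt
  have hfm : Measurable f := hfc.measurable
  have hf'm : Measurable f' := by
    have : Continuous f' := by fun_prop
    exact this.measurable
  have hWm : Measurable W := h.measurable_sum _
  have hDm : ∀ e, Measurable (D e) := fun e => h.measurable_sum _
  have hKm : Measurable K := Finset.measurable_fun_sum _ fun e _ => (h.measurable e).mul (hDm e)
  have hWi : Integrable W P := h.integrable_sum _
  have hKb : ∀ ω, |K ω| ≤ Fintype.card E * (a * β) := fun ω => by
    calc _ ≤ ∑ e, |ξ e ω * D e ω| := Finset.abs_sum_le_sum_abs _ _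
      _ ≤ Finset.univ.card • (a * β) := Finset.sum_le_card_nsmul _ _ _ fun e _ => by
          rw [abs_mul]
          exact mul_le_mul (h.bound e ω) (h.abs_nbr_sum_le ha e ω) (abs_nonneg _) ha
      _ = _ := by rw [nsmul_eq_mul]; rfl
  have hKi : Integrable K P := Integrable.of_bound hKm.aestronglyMeasurable _
    (Eventually.of_forall hKb)
  have hqi : Integrable (fun ω => q (W ω)) P :=
    Integrable.of_bound (hq.comp hWm).aestronglyMeasurable Q (Eventually.of_forall fun ω => hqQ _)
  have hgi : Integrable (fun ω => g (W ω)) P :=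
    Integrable.of_bound (hg.measurable.comp hWm).aestronglyMeasurable 1
      (Eventually.of_forall fun ω => by simpa [abs_of_nonneg (hg0 _)] using hg1 (W ω))
  have hξf : ∀ e (V : Ω → ℝ), Measurable V → Integrable (fun ω => ξ e ω * f (V ω)) P :=
    fun e V hV => by
      refine Integrable.of_bound ((h.measurable e).mul (hfm.comp hV)).aestronglyMeasurable
        (a * (3 / 2)) (Eventually.of_forall fun ω => ?_)
      rw [Real.norm_eq_abs, abs_mul]
      exact mul_le_mul (h.bound e ω) (hf1 _) (abs_nonneg _) ha
  set R : E → Ω → ℝ := fun e ω => f (W ω) - f (W ω - D e ω) - D e ω * f' (W ω) with hR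
  have hRb : ∀ e ω, |R e ω| ≤ β * (β * (3 / 2) + |W ω| * (2 * β) + q (W ω)) := fun e ω => by
    refine abs_sub_sub_mul_le_of_deriv_osc hf (h.abs_nbr_sum_le ha e ω) fun θ hθ => ?_
    refine (stein_deriv_osc hf hf1 hf2 hθ).trans ?_
    gcongr
    exact hosc θ _ hθ
  have hkey : ∀ ω, g (W ω) - c = f' (W ω) * (1 - K ω) - ∑ e, ξ e ω * R e ω -
      ∑ e, ξ e ω * f (W ω - D e ω) := fun ω => by
    have h1 : W ω * f (W ω) = ∑ e, ξ e ω * f (W ω) := by rw [Finset.sum_mul]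
    have h2 : f' (W ω) * K ω = ∑ e, ξ e ω * (D e ω * f' (W ω)) := by
      rw [hK, mul_comm, Finset.sum_mul]
      exact Finset.sum_congr rfl fun e _ => by ring
    have h3 : ∑ e, ξ e ω * R e ω = ∑ e, ξ e ω * f (W ω) - ∑ e, ξ e ω * f (W ω - D e ω) -
        ∑ e, ξ e ω * (D e ω * f' (W ω)) := by
      rw [← Finset.sum_sub_distrib, ← Finset.sum_sub_distrib]
      exact Finset.sum_congr rfl fun e _ => by rw [hR]; ring
    rw [h3, mul_sub, h2, ← h1, hf']
    ring
  have hξfi : ∀ e, Integrable (fun ω => ξ e ω * f (W ω - D e ω)) P := fun e =>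
    hξf e _ (hWm.sub (hDm e))
  have hzero : ∫ ω, ∑ e, ξ e ω * f (W ω - D e ω) ∂P = 0 := by
    rw [integral_finsetSum _ fun e _ => hξfi e]
    refine Finset.sum_eq_zero fun e _ => ?_
    have := h.integral_mul_comp_compl_eq_zero hfm e
    simpa only [sum_compl_eq_sub] using this
  have hpt : ∀ ω, |g (W ω) - c + ∑ e, ξ e ω * f (W ω - D e ω)| ≤ 2 * |1 - K ω| +
      Fintype.card E * a * β * (β * (3 / 2) + |W ω| * (2 * β) + q (W ω)) := fun ω => by
    rw [hkey ω, sub_add_cancel]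
    refine (abs_sub _ _).trans (add_le_add ?_ ?_)
    · rw [abs_mul]
      gcongr
      exact hf2 _
    · calc _ ≤ ∑ e, |ξ e ω * R e ω| := Finset.abs_sum_le_sum_abs _ _
        _ ≤ Finset.univ.card • (a * (β * (β * (3 / 2) + |W ω| * (2 * β) + q (W ω)))) :=
            Finset.sum_le_card_nsmul _ _ _ fun e _ => by
              rw [abs_mul]
              exact mul_le_mul (h.bound e ω) (hRb e ω) (abs_nonneg _) ha
        _ = _ := by rw [nsmul_eq_mul, Finset.card_univ]; ring
  have hsumi : Integrable (fun ω => ∑ e, ξ e ω * f (W ω - D e ω)) P :=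
    integrable_finsetSum _ fun e _ => hξfi e
  have hgc : Integrable (fun ω => g (W ω) - c) P := hgi.sub (integrable_const c)
  have hi1 : Integrable (fun ω => 2 * |1 - K ω|) P :=
    (((integrable_const 1).sub hKi).abs).const_mul 2
  have hi4 : Integrable (fun ω => |W ω| * (2 * β)) P := hWi.abs.mul_const _
  have hi2 : Integrable (fun ω => β * (3 / 2) + |W ω| * (2 * β)) P :=
    (integrable_const _).add hi4
  have hi3 : Integrable (fun ω => Fintype.card E * a * β *
      (β * (3 / 2) + |W ω| * (2 * β) + q (W ω))) P := (hi2.add hqi).const_mul _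
  calc _ = |∫ ω, (g (W ω) - c + ∑ e, ξ e ω * f (W ω - D e ω)) ∂P| := by
        rw [integral_add hgc hsumi, hzero,
          integral_sub hgi (integrable_const c)]
        simp [hW]
    _ ≤ ∫ ω, |g (W ω) - c + ∑ e, ξ e ω * f (W ω - D e ω)| ∂P := abs_integral_le_integral_abs
    _ ≤ ∫ ω, (2 * |1 - K ω| +
          Fintype.card E * a * β * (β * (3 / 2) + |W ω| * (2 * β) + q (W ω))) ∂P :=
        integral_mono (hgc.add hsumi).abs (hi1.add hi3) hpt
    _ = 2 * ∫ ω, |1 - K ω| ∂P + Fintype.card E * a * β *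
          (β * (3 / 2) + (∫ ω, |W ω| ∂P) * (2 * β) + ∫ ω, q (W ω) ∂P) := by
        rw [integral_add hi1 hi3, integral_const_mul, integral_const_mul, integral_add hi2 hqi,
          integral_add (integrable_const _) hi4, integral_mul_const (2 * β)]
        simp
    _ ≤ _ := by
        have := h.integral_abs_sum_le_one
        have h4 : β * (3 / 2) + (∫ ω, |W ω| ∂P) * (2 * β) ≤ 7 / 2 * β := by nlinarith
        gcongr

end LocallyDependent

lemma memLp_two_of_bound {Ω : Type*} [MeasurableSpace Ω] {P : Measure Ω} [IsProbabilityMeasure P]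
    {X : Ω → ℝ} (hX : Measurable X) {b : ℝ} (hb : ∀ ω, |X ω| ≤ b) : MemLp X 2 P :=
  MemLp.of_bound hX.aestronglyMeasurable b (Eventually.of_forall hb)

lemma abs_covariance_le_of_bound {Ω : Type*} [MeasurableSpace Ω] {P : Measure Ω}
    [IsProbabilityMeasure P] {X Y : Ω → ℝ} (hX : Measurable X) (hY : Measurable Y) {b : ℝ}
    (hXb : ∀ ω, |X ω| ≤ b) (hYb : ∀ ω, |Y ω| ≤ b) : |cov[X, Y; P]| ≤ 2 * b ^ 2 := by
  rw [covariance_eq_sub (memLp_two_of_bound hX hXb) (memLp_two_of_bound hY hYb)]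
  have hInt : ∀ {Z : Ω → ℝ} {c : ℝ}, (∀ ω, |Z ω| ≤ c) → |∫ ω, Z ω ∂P| ≤ c := by
    intro Z c hZ
    simpa using norm_integral_le_of_norm_le_const (μ := P) (f := Z) (Eventually.of_forall hZ)
  obtain ⟨ω⟩ : Nonempty Ω := nonempty_of_isProbabilityMeasure P
  have hb : 0 ≤ b := (abs_nonneg _).trans (hXb ω)
  have h1 : |∫ ω, (X * Y) ω ∂P| ≤ b * b := hInt fun ω => by
    rw [Pi.mul_apply, abs_mul]
    exact mul_le_mul (hXb ω) (hYb ω) (abs_nonneg _) hb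
  have h2 : |(∫ ω, X ω ∂P) * ∫ ω, Y ω ∂P| ≤ b * b := by
    rw [abs_mul]
    exact mul_le_mul (hInt hXb) (hInt hYb) (abs_nonneg _) hb
  exact (abs_sub _ _).trans (by linarith)

lemma integral_abs_le_sqrt_integral_sq {Ω : Type*} [MeasurableSpace Ω] {P : Measure Ω}
    [IsProbabilityMeasure P] {X : Ω → ℝ} (hX : MemLp X 2 P) :
    ∫ ω, |X ω| ∂P ≤ √(∫ ω, X ω ^ 2 ∂P) := by
  refine Real.le_sqrt_of_sq_le ?_
  have h := variance_nonneg (fun ω => |X ω|) P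
  have hX' : MemLp (fun ω => |X ω|) 2 P := hX.abs
  rw [variance_eq_sub hX'] at h
  simpa using h

/-- The pairs of adjacent indices for a neighborhood function. -/
def adjacentPairs {E : Type*} [Fintype E] [DecidableEq E] (nbr : E → Finset E) : Finset (E × E) :=
  Finset.univ.filter fun p => p.2 ∈ nbr p.1

lemma card_filter_fst_adjacentPairs_le {E : Type*} [Fintype E] [DecidableEq E]
    {nbr : E → Finset E} {d : ℕ} (hd : ∀ e, (nbr e).card ≤ d) (s : Finset E) :
    ((adjacentPairs nbr).filter fun p => p.1 ∈ s).card ≤ s.card * d := by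
  have : ((adjacentPairs nbr).filter fun p => p.1 ∈ s) ⊆ s.biUnion fun e => {e} ×ˢ nbr e := by
    intro p hp
    simp only [adjacentPairs, Finset.mem_filter, Finset.mem_univ, true_and] at hp
    simp only [Finset.mem_biUnion, Finset.mem_product, Finset.mem_singleton]
    exact ⟨p.1, hp.2, rfl, hp.1⟩
  refine (Finset.card_le_card this).trans (Finset.card_biUnion_le_card_mul _ _ _ fun e _ => ?_)
  simpa using hd e

lemma card_filter_snd_adjacentPairs_le {E : Type*} [Fintype E] [DecidableEq E]
    {nbr : E → Finset E} {d : ℕ} (hd : ∀ e, (nbr e).card ≤ d)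
    (hsymm : ∀ e g, g ∈ nbr e → e ∈ nbr g) (s : Finset E) :
    ((adjacentPairs nbr).filter fun p => p.2 ∈ s).card ≤ s.card * d := by
  have : ((adjacentPairs nbr).filter fun p => p.2 ∈ s) ⊆ s.biUnion fun e => nbr e ×ˢ {e} := by
    intro p hp
    simp only [adjacentPairs, Finset.mem_filter, Finset.mem_univ, true_and] at hp
    simp only [Finset.mem_biUnion, Finset.mem_product, Finset.mem_singleton]
    exact ⟨p.2, hp.2, hsymm _ _ hp.1, rfl⟩
  refine (Finset.card_le_card this).trans (Finset.card_biUnion_le_card_mul _ _ _ fun e _ => ?_)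
  simpa using hd e

lemma sum_mul_nbr_sum_eq {Ω E : Type*} [Fintype E] [DecidableEq E] (nbr : E → Finset E)
    (ξ : E → Ω → ℝ) (ω : Ω) :
    ∑ e, ξ e ω * ∑ g ∈ nbr e, ξ g ω = ∑ p ∈ adjacentPairs nbr, ξ p.1 ω * ξ p.2 ω := by
  rw [adjacentPairs, Finset.sum_filter, Fintype.sum_prod_type]
  refine Finset.sum_congr rfl fun e _ => ?_
  rw [Finset.mul_sum, ← Finset.sum_filter]
  simp

namespace LocallyDependent

variable {Ω E : Type*} [MeasurableSpace Ω] [Fintype E] [DecidableEq E]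
  {P : Measure Ω} [IsProbabilityMeasure P] {nbr : E → Finset E} {ξ : E → Ω → ℝ} {a : ℝ} {d : ℕ}

lemma variance_nbr_sum_le (h : LocallyDependent P nbr ξ a d) (ha : 0 ≤ a) :
    variance (fun ω => ∑ e, ξ e ω * ∑ g ∈ nbr e, ξ g ω) P ≤
      8 * Fintype.card E * d ^ 3 * a ^ 4 := by
  simp_rw [sum_mul_nbr_sum_eq]
  set S := adjacentPairs nbr with hS
  have hm : ∀ p : E × E, Measurable (fun ω => ξ p.1 ω * ξ p.2 ω) := fun p =>
    (h.measurable _).mul (h.measurable _)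
  have hb : ∀ (p : E × E) ω, |ξ p.1 ω * ξ p.2 ω| ≤ a ^ 2 := fun p ω => by
    rw [abs_mul, sq]
    exact mul_le_mul (h.bound _ _) (h.bound _ _) (abs_nonneg _) ha
  have hL : ∀ p : E × E, MemLp (fun ω => ξ p.1 ω * ξ p.2 ω) 2 P := fun p =>
    memLp_two_of_bound (hm p) (hb p)
  rw [variance_fun_sum' fun p _ => hL p]
  have hScard : S.card ≤ Fintype.card E * d := by
    have := card_filter_fst_adjacentPairs_le h.card_nbr Finset.univ
    simpa using this
  have hinner : ∀ p ∈ S, ∑ q ∈ S, cov[fun ω => ξ p.1 ω * ξ p.2 ω, fun ω => ξ q.1 ω * ξ q.2 ω; P] ≤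
      4 * d ^ 2 * (2 * (a ^ 2) ^ 2) := by
    intro p _
    set N := nbr p.1 ∪ nbr p.2 with hN
    have hNcard : N.card ≤ 2 * d := by
      refine (Finset.card_union_le _ _).trans ?_
      linarith [h.card_nbr p.1, h.card_nbr p.2]
    have hcard : (S.filter fun q => q.1 ∈ N ∨ q.2 ∈ N).card ≤ 4 * d ^ 2 := by
      rw [Finset.filter_or]
      refine (Finset.card_union_le _ _).trans ?_
      have h1 := card_filter_fst_adjacentPairs_le h.card_nbr N
      have h2 := card_filter_snd_adjacentPairs_le h.card_nbr h.symm N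
      nlinarith
    calc _ = ∑ q ∈ S.filter (fun q => q.1 ∈ N ∨ q.2 ∈ N),
          cov[fun ω => ξ p.1 ω * ξ p.2 ω, fun ω => ξ q.1 ω * ξ q.2 ω; P] := by
          symm
          refine Finset.sum_filter_of_ne fun q _ hq => ?_
          by_contra hcon
          push Not at hcon
          exact hq ((h.indep_mul _ _ _ _ hcon.1 hcon.2).covariance_eq_zero (hL p) (hL q))
      _ ≤ (S.filter (fun q => q.1 ∈ N ∨ q.2 ∈ N)).card • (2 * (a ^ 2) ^ 2) :=
          Finset.sum_le_card_nsmul _ _ _ fun q _ =>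
            (le_abs_self _).trans (abs_covariance_le_of_bound (hm p) (hm q) (hb p) (hb q))
      _ ≤ _ := by
          rw [nsmul_eq_mul]
          have : ((S.filter (fun q => q.1 ∈ N ∨ q.2 ∈ N)).card : ℝ) ≤ 4 * d ^ 2 := by
            exact_mod_cast hcard
          gcongr
  calc _ ≤ S.card • (4 * d ^ 2 * (2 * (a ^ 2) ^ 2)) := Finset.sum_le_card_nsmul _ _ _ hinner
    _ ≤ Fintype.card E * d * (4 * d ^ 2 * (2 * (a ^ 2) ^ 2)) := by
        rw [nsmul_eq_mul]
        have : (S.card : ℝ) ≤ Fintype.card E * d := by exact_mod_cast hScard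
        gcongr
    _ = _ := by ring

lemma integral_abs_one_sub_nbr_sum_le (h : LocallyDependent P nbr ξ a d) (ha : 0 ≤ a) :
    ∫ ω, |1 - ∑ e, ξ e ω * ∑ g ∈ nbr e, ξ g ω| ∂P ≤ √(8 * Fintype.card E * d ^ 3 * a ^ 4) := by
  set K : Ω → ℝ := fun ω => ∑ e, ξ e ω * ∑ g ∈ nbr e, ξ g ω with hK
  have hKm : Measurable K :=
    Finset.measurable_fun_sum _ fun e _ => (h.measurable e).mul (h.measurable_sum _)
  have hKb : ∀ ω, |K ω| ≤ Fintype.card E * (a * (d * a)) := fun ω => by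
    calc _ ≤ ∑ e, |ξ e ω * ∑ g ∈ nbr e, ξ g ω| := Finset.abs_sum_le_sum_abs _ _
      _ ≤ Finset.univ.card • (a * (d * a)) := Finset.sum_le_card_nsmul _ _ _ fun e _ => by
          rw [abs_mul]
          exact mul_le_mul (h.bound e ω) (h.abs_nbr_sum_le ha e ω) (abs_nonneg _) ha
      _ = _ := by rw [nsmul_eq_mul]; rfl
  have hKL : MemLp K 2 P := memLp_two_of_bound hKm hKb
  have h1 : MemLp (fun ω => 1 - K ω) 2 P := (memLp_const 1).sub hKL
  refine (integral_abs_le_sqrt_integral_sq h1).trans (Real.sqrt_le_sqrt ?_)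
  refine le_trans (le_of_eq ?_) (h.variance_nbr_sum_le ha)
  rw [variance_eq_integral hKm.aemeasurable, h.integral_sum_mul_nbr_sum]
  refine integral_congr_ae (Eventually.of_forall fun ω => ?_)
  change (1 - K ω) ^ 2 = (K ω - 1) ^ 2
  ring

/-- Berry–Esseen bound for locally dependent sums. -/
theorem abs_cdf_sub_le (h : LocallyDependent P nbr ξ a d) (ha : 0 < a) (hd : 0 < d)
    (hE : 0 < Fintype.card E) (z : ℝ) :
    |P.real {ω | ∑ e, ξ e ω ≤ z} - (gaussianReal 0 1).real (Set.Iic z)| ≤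
      4 * √(8 * Fintype.card E * d ^ 3 * a ^ 4) + 12 * Fintype.card E * d ^ 2 * a ^ 3 + d * a := by
  set W : Ω → ℝ := fun ω => ∑ e, ξ e ω with hW
  have hWm : Measurable W := h.measurable_sum _
  set ν := P.map W with hν
  have : IsProbabilityMeasure ν := Measure.isProbabilityMeasure_map hWm.aemeasurable
  have hνF : ∀ z, ν.real (Set.Iic z) = P.real {ω | W ω ≤ z} := fun z =>
    map_measureReal_apply hWm measurableSet_Iic
  set Φ : ℝ → ℝ := fun z => (gaussianReal 0 1).real (Set.Iic z) with hΦ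
  set F : ℝ → ℝ := fun z => ν.real (Set.Iic z) with hF
  have hb1 : ∀ z, |F z - Φ z| ≤ 1 := fun z => by
    rw [abs_le]
    constructor <;> linarith [measureReal_nonneg (μ := ν) (s := Set.Iic z),
      measureReal_le_one (μ := ν) (s := Set.Iic z),
      measureReal_nonneg (μ := gaussianReal 0 1) (s := Set.Iic z),
      measureReal_le_one (μ := gaussianReal 0 1) (s := Set.Iic z)]
  have hbdd : BddAbove (Set.range fun z => |F z - Φ z|) := ⟨1, by rintro _ ⟨z, rfl⟩; exact hb1 z⟩
  set κ := ⨆ z, |F z - Φ z| with hκ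
  have hκle : ∀ z, |F z - Φ z| ≤ κ := le_ciSup hbdd
  set β : ℝ := d * a with hβdef
  have hβ : 0 < β := by positivity
  set γ : ℝ := Fintype.card E * a * β ^ 2 with hγdef
  have hγ : 0 < γ := by positivity
  set Δ : ℝ := √(8 * Fintype.card E * d ^ 3 * a ^ 4) with hΔdef
  have hΔ := h.integral_abs_one_sub_nbr_sum_le ha.le
  set ε : ℝ := 4 * γ with hεdef
  have hε : 0 < ε := by positivity
  have hsmooth : ∀ z, |∫ x, smoothStep z ε x ∂ν - ∫ x, smoothStep z ε x ∂gaussianReal 0 1| ≤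
      2 * Δ + 4 * γ + κ / 2 + β / 2 := by
    intro z
    set I := Set.Icc (z - β) (z + ε + β) with hI
    have hmain := h.abs_integral_comp_sub_le ha.le (continuous_smoothStep z ε)
      (smoothStep_nonneg z ε) (smoothStep_le_one z ε)
      (q := I.indicator fun _ => β / ε) (Q := β / ε)
      (measurable_const.indicator measurableSet_Icc)
      (fun x => by
        have h0 : 0 ≤ β / ε := by positivity
        by_cases hx : x ∈ I
        · simp [hx, abs_of_nonneg h0]
        · simpa [hx] using h0)
      (fun θ w hθ => abs_smoothStep_sub_le_indicator hε hθ)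
    rw [hν, integral_map hWm.aemeasurable (continuous_smoothStep z ε).aestronglyMeasurable]
    have hq : ∫ ω, I.indicator (fun _ => β / ε) (∑ e, ξ e ω) ∂P = ν.real I * (β / ε) := by
      rw [hν, ← integral_map (f := I.indicator fun _ => β / ε) hWm.aemeasurable
        (measurable_const.indicator measurableSet_Icc).aestronglyMeasurable,
        integral_indicator_const _ measurableSet_Icc, smul_eq_mul]
    have hI1 : ν.real I ≤ 2 * κ + (ε + 3 * β) / 2 := by
      have h1 : ν.real I + F (z - 2 * β) ≤ F (z + ε + β) := by
        rw [hF]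
        dsimp only
        rw [← measureReal_union _ measurableSet_Iic]
        · refine measureReal_mono ?_
          rintro x (hx | hx)
          · exact hx.2
          · have : x ≤ z - 2 * β := hx
            change x ≤ z + ε + β
            linarith
        · rw [Set.disjoint_left]
          intro x hx hx2
          have h2 : x ≤ z - 2 * β := hx2
          linarith [hx.1]
      have h2 := gaussianReal_cdf_sub_le (a := z - 2 * β) (b := z + ε + β) (by linarith)
      have h3 := abs_le.1 (hκle (z - 2 * β))
      have h4 := abs_le.1 (hκle (z + ε + β))
      have h5 : Φ (z + ε + β) ≤ Φ (z - 2 * β) + (z + ε + β - (z - 2 * β)) / 2 := h2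
      linarith
    rw [hq] at hmain
    refine hmain.trans ?_
    have h6 : Fintype.card E * a * β * (7 / 2 * β + ν.real I * (β / ε)) =
        7 / 2 * γ + ν.real I / 4 := by
      rw [hεdef, hγdef]
      have : (Fintype.card E : ℝ) ≠ 0 := by exact_mod_cast hE.ne'
      field_simp
    rw [h6]
    linarith
  have hκ2 : ∀ z, |F z - Φ z| ≤ 2 * Δ + 6 * γ + κ / 2 + β / 2 := by
    intro z
    have h1 := abs_le.1 (hsmooth z)
    have h2 := abs_le.1 (hsmooth (z - ε))
    have h3 : F z ≤ _ := cdf_le_integral_smoothStep (ν := ν) (z := z) hε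
    have h4 := integral_smoothStep_le_cdf (ν := gaussianReal 0 1) (z := z) hε
    have h5 := cdf_le_integral_smoothStep (ν := gaussianReal 0 1) (z := z - ε) hε
    have h6 := integral_smoothStep_le_cdf (ν := ν) (z := z - ε) hε
    rw [sub_add_cancel] at h6
    have h7 := gaussianReal_cdf_sub_le (a := z) (b := z + ε) (by linarith)
    have h8 := gaussianReal_cdf_sub_le (a := z - ε) (b := z) (by linarith)
    rw [abs_le]
    constructor
    · change _ ≤ ν.real _ - (gaussianReal 0 1).real _
      linarith
    · change ν.real _ - (gaussianReal 0 1).real _ ≤ _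
      have h9 : ν.real (Set.Iic z) ≤ _ := h3
      linarith
  have hfin : κ ≤ 2 * Δ + 6 * γ + κ / 2 + β / 2 := ciSup_le hκ2
  rw [← hνF]
  refine (hκle z).trans ?_
  have : 12 * Fintype.card E * d ^ 2 * a ^ 3 = 12 * γ := by rw [hγdef, hβdef]; ring
  rw [this]
  linarith

end LocallyDependent

/-! ### Crossings of labelled chords -/

/-- The chords `{a, b}` and `{c, d}` cross, the first chord having the smallest endpoint. -/
def Interleaved {α : Type*} [LinearOrder α] (p q : α × α) : Prop :=
  min p.1 p.2 < min q.1 q.2 ∧ min q.1 q.2 < max p.1 p.2 ∧ max p.1 p.2 < max q.1 q.2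

instance {α : Type*} [LinearOrder α] (p q : α × α) : Decidable (Interleaved p q) := by
  unfold Interleaved; infer_instance

/-- The endpoints of the chord `i`. -/
def endpoints {ι α : Type*} (f : ι × Bool → α) (i : ι) : α × α := (f (i, false), f (i, true))

/-- The number of crossings between the chords with endpoints labelled by `f`. -/
def crossCount {ι α : Type*} [Fintype ι] [LinearOrder α] (f : ι × Bool → α) : ℕ :=
  (Finset.univ.filter fun p : ι × ι => Interleaved (endpoints f p.1) (endpoints f p.2)).card

lemma crossCount_congr {ι α β : Type*} [Fintype ι] [LinearOrder α] [LinearOrder β]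
    {f : ι × Bool → α} {g : ι × Bool → β} (h : ∀ a b, f a < f b ↔ g a < g b) :
    crossCount f = crossCount g := by
  unfold crossCount
  congr 1
  refine Finset.filter_congr fun p _ => ?_
  simp only [Interleaved, endpoints, lt_min_iff, min_lt_iff, lt_max_iff, max_lt_iff, h]

lemma exists_equiv_lt_iff {κ α : Type*} [Fintype κ] [LinearOrder α] {N : ℕ}
    (hN : Fintype.card κ = N) {f : κ → α} (hf : Function.Injective f) :
    ∃ r : κ ≃ Fin N, ∀ a b, f a < f b ↔ r a < r b := by
  let _ : LinearOrder κ := LinearOrder.lift' f hf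
  let e := Fintype.orderIsoFinOfCardEq κ hN
  exact ⟨e.symm.toEquiv, fun a b => (e.symm.lt_iff_lt (x := a) (y := b)).symm⟩

/-- The involution exchanging the two endpoints of every chord. -/
def swapEnds (ι : Type*) : Equiv.Perm (ι × Bool) := Equiv.prodCongr (Equiv.refl ι) Equiv.boolNot

@[simp] lemma swapEnds_apply {ι : Type*} (x : ι × Bool) : swapEnds ι x = (x.1, !x.2) := rfl

/-- The chord diagram obtained by labelling the endpoints of the chords. -/
def diagram {ι κ : Type*} (r : ι × Bool ≃ κ) : Equiv.Perm κ := r.permCongr (swapEnds ι)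

lemma diagram_apply {ι κ : Type*} (r : ι × Bool ≃ κ) (x : ι × Bool) :
    diagram r (r x) = r (x.1, !x.2) := by
  simp [diagram, Equiv.permCongr_apply]

lemma isChordDiagram_diagram {n : ℕ} (r : Fin n × Bool ≃ Fin (2 * n)) :
    IsChordDiagram (diagram r) := by
  constructor <;> intro i <;> obtain ⟨x, rfl⟩ := r.surjective i
  · simp [diagram_apply]
  · rw [diagram_apply, r.injective.ne_iff]
    intro h
    simpa using congrArg Prod.snd h

lemma crossings_diagram {n : ℕ} (r : Fin n × Bool ≃ Fin (2 * n)) :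
    crossings (diagram r) = crossCount r := by
  symm
  refine Finset.card_nbij' (fun p => (min (r (p.1, false)) (r (p.1, true)),
    min (r (p.2, false)) (r (p.2, true)), max (r (p.1, false)) (r (p.1, true)),
    max (r (p.2, false)) (r (p.2, true)))) (fun q => ((r.symm q.1).1, (r.symm q.2.1).1))
    ?_ ?_ ?_ ?_
  · intro p hp
    have hm : ∀ i, diagram r (min (r (i, false)) (r (i, true))) =
        max (r (i, false)) (r (i, true)) := fun i => by
      rcases le_total (r (i, false)) (r (i, true)) with h | h <;> simp [h, diagram_apply]
    simpa [Interleaved, endpoints, hm] using hp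
  · intro q hq
    obtain ⟨q1, q2, q3, q4⟩ := q
    obtain ⟨⟨i, b⟩, rfl⟩ := r.surjective q1
    obtain ⟨⟨j, c⟩, rfl⟩ := r.surjective q2
    simp only [Finset.coe_filter, Finset.mem_univ, true_and, Set.mem_ofPred_eq,
      diagram_apply] at hq
    obtain ⟨h1, h2, h3, rfl, rfl⟩ := hq
    have h4 := h1.trans h2
    have h5 := h2.trans h3
    have h6 := h1.trans h5
    cases b <;> cases c <;> simp_all [Interleaved, endpoints]
  · intro p _
    have : ∀ i, (r.symm (min (r (i, false)) (r (i, true)))).1 = i := fun i => by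
      rcases le_total (r (i, false)) (r (i, true)) with h | h <;> simp [h]
    simp [this]
  · intro q hq
    obtain ⟨q1, q2, q3, q4⟩ := q
    obtain ⟨⟨i, b⟩, rfl⟩ := r.surjective q1
    obtain ⟨⟨j, c⟩, rfl⟩ := r.surjective q2
    simp only [Finset.coe_filter, Finset.mem_univ, true_and, Set.mem_ofPred_eq,
      diagram_apply] at hq
    obtain ⟨h1, h2, h3, rfl, rfl⟩ := hq
    have h4 := h1.trans h2
    have h5 := h2.trans h3
    cases b <;> cases c <;> simp_all [le_of_lt]

lemma IsChordDiagram.isConj {n : ℕ} {π π' : Equiv.Perm (Fin (2 * n))} (h : IsChordDiagram π)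
    (h' : IsChordDiagram π') : IsConj π π' := by
  rcases Nat.eq_zero_or_pos n with rfl | hn
  · rw [show π = π' from Equiv.ext fun i => Fin.elim0 (by simpa using i)]
  have key : ∀ ρ : Equiv.Perm (Fin (2 * n)), IsChordDiagram ρ →
      ρ.cycleType = Multiset.replicate n 2 := fun ρ hρ => by
    have hord : orderOf ρ = 2 := by
      refine orderOf_eq_prime (Equiv.ext fun i => ?_) fun h1 => ?_
      · simpa [sq] using hρ.1 i
      · exact hρ.2 ⟨0, by omega⟩ (by rw [h1]; rfl)
    obtain ⟨k, hk⟩ := Equiv.Perm.cycleType_prime_order (σ := ρ) (by rw [hord]; exact Nat.prime_two)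
    have hsupp : ρ.support = Finset.univ := by
      ext i
      simpa using hρ.2 i
    have hsum := ρ.sum_cycleType
    rw [hk, hord, hsupp] at hsum
    simp at hsum
    rw [hk, hord, show k + 1 = n by omega]
  rw [Equiv.Perm.isConj_iff_cycleType_eq, key π h, key π' h']

lemma card_filter_diagram_eq {n : ℕ} {π π' : Equiv.Perm (Fin (2 * n))} (h : IsChordDiagram π)
    (h' : IsChordDiagram π') :
    (Finset.univ.filter fun r : Fin n × Bool ≃ Fin (2 * n) => diagram r = π).card =
      (Finset.univ.filter fun r : Fin n × Bool ≃ Fin (2 * n) => diagram r = π').card := by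
  obtain ⟨σ, hσ⟩ := isConj_iff.1 (h.isConj h')
  have htr : ∀ (r : Fin n × Bool ≃ Fin (2 * n)) (τ : Equiv.Perm (Fin (2 * n))),
      diagram (r.trans τ) = τ * diagram r * τ⁻¹ := fun r τ => by
    ext i
    simp [diagram, Equiv.permCongr_apply]
  refine Finset.card_nbij' (fun r => r.trans σ) (fun r => r.trans σ⁻¹) ?_ ?_ ?_ ?_
  · intro r hr
    have hr : diagram r = π := by simpa using hr
    simp [htr, hr, hσ]
  · intro r hr
    have hr : diagram r = π' := by simpa using hr
    simp only [Finset.coe_filter, Finset.mem_univ, true_and, Set.mem_ofPred_eq, htr, hr, ← hσ]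
    group
  · intro r _
    ext; simp
  · intro r _
    ext; simp

lemma integral_uniformOn_finset {Ω : Type*} [Fintype Ω] [DecidableEq Ω] [MeasurableSpace Ω]
    [MeasurableSingletonClass Ω] (s : Finset Ω) (f : Ω → ℝ) :
    ∫ ω, f ω ∂uniformOn (s : Set Ω) = (∑ ω ∈ s, f ω) / s.card := by
  rcases s.eq_empty_or_nonempty with rfl | hs
  · simp [uniformOn_empty_meas]
  have : IsProbabilityMeasure (uniformOn (s : Set Ω)) :=
    isProbabilityMeasure_uniformOn s.finite_toSet hs
  rw [integral_fintype .of_finite, Finset.sum_div, ← Finset.sum_subset (Finset.subset_univ s)]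
  · refine Finset.sum_congr rfl fun ω hω => ?_
    rw [measureReal_def, ← Finset.coe_singleton, uniformOn_apply_finset,
      Finset.inter_singleton_of_mem hω]
    simp
    ring
  · intro ω _ hω
    rw [measureReal_def, ← Finset.coe_singleton, uniformOn_apply_finset,
      Finset.inter_singleton_of_notMem hω]
    simp

instance {n : ℕ} : DecidablePred (IsChordDiagram (n := n)) := fun π => by
  unfold IsChordDiagram
  infer_instance

lemma sum_crossCount_eq (n : ℕ) : ∃ K : ℕ, ∀ F : ℕ → ℝ,
    ∑ r : Fin n × Bool ≃ Fin (2 * n), F (crossCount r) =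
      K * ∑ π with IsChordDiagram (n := n) π, F (crossings π) := by
  classical
  have hcard : Fintype.card (Fin n × Bool) = Fintype.card (Fin (2 * n)) := by simp [mul_comm]
  obtain ⟨r₀⟩ : Nonempty (Fin n × Bool ≃ Fin (2 * n)) := Fintype.card_eq.1 hcard
  refine ⟨(Finset.univ.filter fun r : Fin n × Bool ≃ Fin (2 * n) =>
    diagram r = diagram r₀).card, fun F => ?_⟩
  rw [← Finset.sum_fiberwise_of_maps_to (g := diagram)
    (t := Finset.univ.filter fun π => IsChordDiagram (n := n) π)
    (fun r _ => by simpa using isChordDiagram_diagram r), Finset.mul_sum]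
  refine Finset.sum_congr rfl fun π hπ => ?_
  rw [card_filter_diagram_eq (isChordDiagram_diagram r₀) (Finset.mem_filter.1 hπ).2,
    ← nsmul_eq_mul, ← Finset.sum_const]
  refine Finset.sum_congr rfl fun r hr => ?_
  rw [← (Finset.mem_filter.1 hr).2, crossings_diagram]

/-! ### Independent uniform endpoints -/

/-- The uniform distribution on `[0, 1]`. -/
noncomputable def unitMeasure : Measure ℝ := volume.restrict (Set.Icc 0 1)

instance : IsProbabilityMeasure unitMeasure := ⟨by simp [unitMeasure]⟩

instance : NullSingletonClass unitMeasure := by unfold unitMeasure; infer_instance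

/-- The law of independent uniform endpoints of chords indexed by `ι`. -/
noncomputable def endpointsMeasure (ι : Type*) [Fintype ι] : Measure (ι × Bool → ℝ) :=
  Measure.pi fun _ => unitMeasure

lemma measurableSet_interleaved {ι : Type*} (i j : ι) :
    MeasurableSet {u : ι × Bool → ℝ | Interleaved (endpoints u i) (endpoints u j)} := by
  unfold Interleaved endpoints
  have hmin : ∀ i : ι, Measurable fun u : ι × Bool → ℝ => min (u (i, false)) (u (i, true)) := by
    fun_prop
  have hmax : ∀ i : ι, Measurable fun u : ι × Bool → ℝ => max (u (i, false)) (u (i, true)) := by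
    fun_prop
  exact (measurableSet_lt (hmin i) (hmin j)).inter
    ((measurableSet_lt (hmin j) (hmax i)).inter (measurableSet_lt (hmax i) (hmax j)))

section

variable {ι : Type*} [Fintype ι]

instance : IsProbabilityMeasure (endpointsMeasure ι) := by unfold endpointsMeasure; infer_instance

lemma map_eval_endpointsMeasure (a : ι × Bool) :
    (endpointsMeasure ι).map (fun u => u a) = unitMeasure :=
  (measurePreserving_eval _ a).map_eq

lemma iIndepFun_eval : iIndepFun (fun (a : ι × Bool) (u : ι × Bool → ℝ) => u a)
    (endpointsMeasure ι) :=
  iIndepFun_pi (X := fun _ x => x) fun _ => aemeasurable_id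

lemma map_eval_pair {a b : ι × Bool} (hab : a ≠ b) :
    (endpointsMeasure ι).map (fun u => (u a, u b)) = unitMeasure.prod unitMeasure := by
  have := iIndepFun_eval.indepFun hab
  rw [indepFun_iff_map_prod_eq_prod_map_map (measurable_pi_apply a).aemeasurable
    (measurable_pi_apply b).aemeasurable] at this
  rw [this, map_eval_endpointsMeasure, map_eval_endpointsMeasure]

lemma ae_injective_endpointsMeasure : ∀ᵐ u ∂endpointsMeasure ι, Function.Injective u := by
  have h : ∀ a b : ι × Bool, a ≠ b → ∀ᵐ u ∂endpointsMeasure ι, u a ≠ u b := by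
    intro a b hab
    have hm : Measurable fun u : ι × Bool → ℝ => (u a, u b) := by fun_prop
    refine ae_of_ae_map (p := fun x : ℝ × ℝ => x.1 ≠ x.2) hm.aemeasurable ?_
    rw [map_eval_pair hab, ae_iff, Measure.measure_prod_null]
    · refine Eventually.of_forall fun x => ?_
      change unitMeasure (Prod.mk x ⁻¹' {a : ℝ × ℝ | ¬a.1 ≠ a.2}) = 0
      have : (Prod.mk x ⁻¹' {a : ℝ × ℝ | ¬a.1 ≠ a.2}) = {x} := by
        ext y; simp [eq_comm]
      rw [this]
      simp
    · simpa using measurableSet_eq_fun measurable_fst measurable_snd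
  have h' : ∀ᵐ u ∂endpointsMeasure ι, ∀ a b : ι × Bool, a ≠ b → u a ≠ u b := by
    simp only [ae_all_iff]
    exact h
  filter_upwards [h'] with u hu a b
  contrapose
  exact hu a b

lemma measurePreserving_comp_perm (τ : Equiv.Perm (ι × Bool)) :
    MeasurePreserving (fun u : ι × Bool → ℝ => u ∘ τ) (endpointsMeasure ι) (endpointsMeasure ι) := by
  have := measurePreserving_piCongrLeft (fun _ : ι × Bool => unitMeasure) τ.symm
  unfold endpointsMeasure
  convert this using 1
  ext u a
  simp [MeasurableEquiv.piCongrLeft, Equiv.piCongrLeft, Equiv.piCongrLeft']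

lemma measurable_crossCount : Measurable (crossCount : (ι × Bool → ℝ) → ℕ) := by
  have : (crossCount : (ι × Bool → ℝ) → ℕ) = fun u => ∑ p : ι × ι,
      {u : ι × Bool → ℝ | Interleaved (endpoints u p.1) (endpoints u p.2)}.indicator 1 u := by
    ext u
    simp [crossCount, Set.indicator_apply]
  rw [this]
  exact Finset.measurable_fun_sum _ fun p _ =>
    measurable_one.indicator (measurableSet_interleaved p.1 p.2)

lemma integrable_comp_crossCount (F : ℕ → ℝ) :
    Integrable (fun u => F (crossCount u)) (endpointsMeasure ι) := by
  refine Integrable.of_bound ((measurable_from_top (f := F)).comp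
    measurable_crossCount).aestronglyMeasurable
    (∑ k ∈ Finset.range (Fintype.card (ι × ι) + 1), |F k|) (Eventually.of_forall fun u => ?_)
  refine Finset.single_le_sum (f := fun k => |F k|) (fun _ _ => abs_nonneg _) ?_
  rw [Finset.mem_range, Nat.lt_succ_iff]
  exact Finset.card_le_univ _

end

theorem integral_comp_crossings_uniformCD (n : ℕ) (F : ℕ → ℝ) :
    ∫ π, F (crossings π) ∂uniformCD n =
      ∫ u, F (crossCount u) ∂endpointsMeasure (Fin n) := by
  classical
  have hcard : Fintype.card (Fin n × Bool) = 2 * n := by simp [mul_comm]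
  obtain ⟨K, hK⟩ := sum_crossCount_eq n
  set S := Finset.univ.filter fun π => IsChordDiagram (n := n) π with hS
  set T := Fintype.card (Equiv.Perm (Fin n × Bool))
  have hT : (T : ℝ) ≠ 0 := by exact_mod_cast Fintype.card_ne_zero
  have hae : ∀ G : ℕ → ℝ, ∀ u : Fin n × Bool → ℝ, Function.Injective u →
      ∑ τ : Equiv.Perm (Fin n × Bool), G (crossCount (u ∘ τ)) =
        K * ∑ π ∈ S, G (crossings π) := by
    intro G u hu
    obtain ⟨r, hr⟩ := exists_equiv_lt_iff hcard hu
    rw [← hK G, ← (Equiv.equivCongr (Equiv.refl _) r).sum_comp]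
    refine Finset.sum_congr rfl fun τ _ => ?_
    congr 1
    exact crossCount_congr fun a b => hr _ _
  have hmain : ∀ G : ℕ → ℝ, T * ∫ u, G (crossCount u) ∂endpointsMeasure (Fin n) =
      K * ∑ π ∈ S, G (crossings π) := by
    intro G
    have h1 : ∀ τ : Equiv.Perm (Fin n × Bool), Integrable (fun u : Fin n × Bool → ℝ =>
        G (crossCount (u ∘ τ))) (endpointsMeasure (Fin n)) := fun τ =>
      (measurePreserving_comp_perm τ).integrable_comp_of_integrable (integrable_comp_crossCount G)
    have h2 : ∀ τ : Equiv.Perm (Fin n × Bool),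
        ∫ u, G (crossCount (u ∘ τ)) ∂endpointsMeasure (Fin n) =
          ∫ u, G (crossCount u) ∂endpointsMeasure (Fin n) := fun τ => by
      conv_rhs => rw [← (measurePreserving_comp_perm τ).map_eq]
      rw [integral_map (measurePreserving_comp_perm τ).measurable.aemeasurable]
      rw [(measurePreserving_comp_perm τ).map_eq]
      exact (integrable_comp_crossCount G).aestronglyMeasurable
    calc _ = ∑ τ : Equiv.Perm (Fin n × Bool),
          ∫ u, G (crossCount (u ∘ τ)) ∂endpointsMeasure (Fin n) := by
          simp [h2, T]
      _ = ∫ u, ∑ τ : Equiv.Perm (Fin n × Bool), G (crossCount (u ∘ τ))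
          ∂endpointsMeasure (Fin n) := (integral_finsetSum _ fun τ _ => h1 τ).symm
      _ = ∫ u, K * ∑ π ∈ S, G (crossings π) ∂endpointsMeasure (Fin n) :=
          integral_congr_ae (ae_injective_endpointsMeasure.mono fun u hu => hae G u hu)
      _ = _ := by simp
  have h1 := hmain fun _ => 1
  have hF := hmain F
  have hset : {π : Equiv.Perm (Fin (2 * n)) | IsChordDiagram π} = (S : Set _) := by
    ext π; simp [hS]
  rw [uniformCD, hset, integral_uniformOn_finset]
  simp at h1
  rw [h1, mul_assoc] at hF
  rw [h1] at hT
  have hKne : (K : ℝ) ≠ 0 := left_ne_zero_of_mul hT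
  have hSne : (S.card : ℝ) ≠ 0 := right_ne_zero_of_mul hT
  have := mul_left_cancel₀ hKne hF
  field_simp
  linarith

/-! ### The variance of the number of crossings -/

/-- The uniform distribution on the unit square, the law of the endpoints of a chord. -/
noncomputable def squareMeasure : Measure (ℝ × ℝ) := unitMeasure.prod unitMeasure

instance : IsProbabilityMeasure squareMeasure := by unfold squareMeasure; infer_instance

/-- The indicator function of the event that two chords cross. -/
noncomputable def crossInd (p q : ℝ × ℝ) : ℝ :=
  (if Interleaved p q then 1 else 0) + if Interleaved q p then 1 else 0

/-- The probability that a random chord crosses the chord `p`. -/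
noncomputable def crossProb (p : ℝ × ℝ) : ℝ := ∫ q, crossInd p q ∂squareMeasure

lemma crossInd_nonneg (p q : ℝ × ℝ) : 0 ≤ crossInd p q := by
  unfold crossInd
  positivity

lemma crossInd_le_one (p q : ℝ × ℝ) : crossInd p q ≤ 1 := by
  unfold crossInd
  by_cases h : Interleaved p q
  · have h' : ¬ Interleaved q p := fun h' => lt_asymm h.1 h'.1
    simp [h, h']
  · simp only [h, if_false, zero_add]
    split_ifs <;> norm_num

lemma crossInd_comm (p q : ℝ × ℝ) : crossInd p q = crossInd q p := add_comm _ _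

lemma crossInd_self (p : ℝ × ℝ) : crossInd p p = 0 := by
  have : ¬ Interleaved p p := fun h => lt_irrefl _ h.1
  simp [crossInd, this]

lemma abs_crossInd_le_one (p q : ℝ × ℝ) : |crossInd p q| ≤ 1 := by
  rw [abs_of_nonneg (crossInd_nonneg p q)]
  exact crossInd_le_one p q

lemma measurable_crossInd : Measurable fun x : (ℝ × ℝ) × (ℝ × ℝ) => crossInd x.1 x.2 := by
  have h : ∀ f g : (ℝ × ℝ) × (ℝ × ℝ) → ℝ × ℝ, Measurable f → Measurable g →
      MeasurableSet {x | Interleaved (f x) (g x)} := fun f g hf hg => by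
    unfold Interleaved
    have hmin : ∀ f : (ℝ × ℝ) × (ℝ × ℝ) → ℝ × ℝ, Measurable f →
      Measurable fun x => min (f x).1 (f x).2 := by fun_prop
    have hmax : ∀ f : (ℝ × ℝ) × (ℝ × ℝ) → ℝ × ℝ, Measurable f →
      Measurable fun x => max (f x).1 (f x).2 := by fun_prop
    exact (measurableSet_lt (hmin f hf) (hmin g hg)).inter
      ((measurableSet_lt (hmin g hg) (hmax f hf)).inter (measurableSet_lt (hmax f hf) (hmax g hg)))
  exact (Measurable.ite (h _ _ measurable_fst measurable_snd) measurable_const measurable_const).add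
    (Measurable.ite (h _ _ measurable_snd measurable_fst) measurable_const measurable_const)

lemma measurable_crossProb : Measurable crossProb :=
  (measurable_crossInd.stronglyMeasurable.integral_prod_right
    (f := fun p q => crossInd p q)).measurable

lemma abs_crossProb_le_one (p : ℝ × ℝ) : |crossProb p| ≤ 1 := by
  have := norm_integral_le_of_norm_le_const (μ := squareMeasure) (f := crossInd p)
    (Eventually.of_forall fun q => abs_crossInd_le_one p q)
  simpa [crossProb] using this

lemma ite_interleaved_add_ite {a b c d : ℝ} (hab : a ≤ b) (hcd : c ≤ d) (h1 : c ≠ a) (h2 : c ≠ b)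
    (h3 : d ≠ a) (h4 : d ≠ b) :
    ((if a < c ∧ c < b ∧ b < d then 1 else 0) + if c < a ∧ a < d ∧ d < b then 1 else 0 : ℝ) =
      (if a < c ∧ c < b then 1 else 0) * (1 - if a < d ∧ d < b then 1 else 0) +
        (1 - if a < c ∧ c < b then 1 else 0) * (if a < d ∧ d < b then 1 else 0) := by
  rcases lt_or_gt_of_ne h1 with h1 | h1 <;> rcases lt_or_gt_of_ne h2 with h2 | h2 <;>
    rcases lt_or_gt_of_ne h3 with h3 | h3 <;> rcases lt_or_gt_of_ne h4 with h4 | h4 <;>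
    first
    | (exfalso; linarith)
    | simp [h1, h2, h3, h4, not_lt_of_gt]

lemma crossInd_eq {p q : ℝ × ℝ} (h1 : q.1 ≠ p.1) (h2 : q.1 ≠ p.2) (h3 : q.2 ≠ p.1)
    (h4 : q.2 ≠ p.2) : crossInd p q =
      (Set.Ioo (min p.1 p.2) (max p.1 p.2)).indicator 1 q.1 *
        (1 - (Set.Ioo (min p.1 p.2) (max p.1 p.2)).indicator 1 q.2) +
      (1 - (Set.Ioo (min p.1 p.2) (max p.1 p.2)).indicator 1 q.1) *
        (Set.Ioo (min p.1 p.2) (max p.1 p.2)).indicator 1 q.2 := by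
  obtain ⟨a, b⟩ := p
  obtain ⟨c, d⟩ := q
  simp only [crossInd, Interleaved, Set.indicator_apply, Set.mem_Ioo, Pi.one_apply] at *
  rcases le_total a b with h | h <;> rcases le_total c d with h' | h' <;>
    simp only [h, h', min_eq_left, min_eq_right, max_eq_left, max_eq_right]
  · exact ite_interleaved_add_ite h h' h1 h2 h3 h4
  · rw [ite_interleaved_add_ite h h' h3 h4 h1 h2]
    ring
  · exact ite_interleaved_add_ite h h' h2 h1 h4 h3
  · rw [ite_interleaved_add_ite h h' h4 h3 h2 h1]
    ring

lemma ae_squareMeasure {s : ℝ → Prop} (hs : ∀ᵐ x ∂unitMeasure, s x) :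
    ∀ᵐ p ∂squareMeasure, s p.1 ∧ s p.2 :=
  (Measure.quasiMeasurePreserving_fst.ae hs).and (Measure.quasiMeasurePreserving_snd.ae hs)

lemma crossProb_eq {p : ℝ × ℝ} (h1 : p.1 ∈ Set.Icc (0 : ℝ) 1) (h2 : p.2 ∈ Set.Icc (0 : ℝ) 1) :
    crossProb p = 2 * (|p.1 - p.2| * (1 - |p.1 - p.2|)) := by
  set f : ℝ → ℝ := (Set.Ioo (min p.1 p.2) (max p.1 p.2)).indicator 1 with hf
  have hInt : ∫ x, f x ∂unitMeasure = |p.1 - p.2| := by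
    rw [hf, integral_indicator_one measurableSet_Ioo, unitMeasure,
      measureReal_restrict_apply measurableSet_Ioo, Set.inter_eq_left.2]
    · rw [Real.volume_real_Ioo_of_le min_le_max, max_sub_min_eq_abs, abs_sub_comm]
    · intro x hx
      exact ⟨(le_min h1.1 h2.1).trans hx.1.le, hx.2.le.trans (max_le h1.2 h2.2)⟩
  have hfi : Integrable f unitMeasure :=
    (integrable_const (1 : ℝ)).indicator measurableSet_Ioo
  have hInt' : ∫ x, (1 - f x) ∂unitMeasure = 1 - |p.1 - p.2| := by
    rw [integral_sub (integrable_const _) hfi, hInt]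
    simp
  have hfi' : Integrable (fun x => 1 - f x) unitMeasure := (integrable_const 1).sub hfi
  have hae : ∀ᵐ q ∂squareMeasure, crossInd p q =
      f q.1 * (1 - f q.2) + (1 - f q.1) * f q.2 := by
    have h : ∀ a, ∀ᵐ x ∂unitMeasure, x ≠ a := fun a => by simp [ae_iff]
    filter_upwards [ae_squareMeasure (h p.1), ae_squareMeasure (h p.2)] with q hq1 hq2
    exact crossInd_eq hq1.1 hq2.1 hq1.2 hq2.2
  rw [crossProb, integral_congr_ae hae, squareMeasure,
    integral_add (hfi.mul_prod hfi') (hfi'.mul_prod hfi),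
    integral_prod_mul f (fun x => 1 - f x), integral_prod_mul (fun x => 1 - f x) f, hInt, hInt']
  ring

lemma ae_unitMeasure_mem : ∀ᵐ x ∂unitMeasure, x ∈ Set.Icc (0 : ℝ) 1 :=
  ae_restrict_mem measurableSet_Icc

lemma integral_unitMeasure (f : ℝ → ℝ) : ∫ x, f x ∂unitMeasure = ∫ x in (0 : ℝ)..1, f x := by
  rw [unitMeasure, integral_Icc_eq_integral_Ioc, intervalIntegral.integral_of_le zero_le_one]

lemma integral_comp_abs_sub {f : ℝ → ℝ} (hf : Continuous f) (hsymm : ∀ t, f (1 - t) = f t)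
    {x : ℝ} (hx : x ∈ Set.Icc (0 : ℝ) 1) :
    ∫ y in (0 : ℝ)..1, f |x - y| = ∫ t in (0 : ℝ)..1, f t := by
  have hi : ∀ a b : ℝ, IntervalIntegrable (fun y => f |x - y|) volume a b := fun a b =>
    Continuous.intervalIntegrable (by fun_prop) a b
  have hi' : ∀ a b : ℝ, IntervalIntegrable f volume a b := hf.intervalIntegrable
  rw [← intervalIntegral.integral_add_adjacent_intervals (hi 0 x) (hi x 1)]
  have h1 : ∫ y in (0 : ℝ)..x, f |x - y| = ∫ t in (0 : ℝ)..x, f t := by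
    rw [intervalIntegral.integral_congr (g := fun y => f (x - y)),
      intervalIntegral.integral_comp_sub_left f]
    · simp
    · intro y hy
      rw [Set.uIcc_of_le hx.1] at hy
      simp only [abs_of_nonneg (sub_nonneg.2 hy.2)]
  have h2 : ∫ y in x..1, f |x - y| = ∫ t in x..1, f t := by
    rw [intervalIntegral.integral_congr (g := fun y => f ((1 + x) - y)),
      intervalIntegral.integral_comp_sub_left f]
    · simp
    · intro y hy
      rw [Set.uIcc_of_le hx.2] at hy
      dsimp only
      rw [abs_sub_comm, abs_of_nonneg (sub_nonneg.2 hy.1), ← hsymm]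
      ring_nf
  rw [h1, h2, intervalIntegral.integral_add_adjacent_intervals (hi' _ _) (hi' _ _)]

lemma integral_crossProb_pow (k : ℕ) : ∫ p, crossProb p ^ k ∂squareMeasure =
    ∫ t in (0 : ℝ)..1, (2 * (t * (1 - t))) ^ k := by
  have hi : Integrable (fun p => crossProb p ^ k) squareMeasure :=
    Integrable.of_bound (measurable_crossProb.pow_const k).aestronglyMeasurable 1
      (Eventually.of_forall fun p => by
        simpa using pow_le_one₀ (abs_nonneg _) (abs_crossProb_le_one p))
  rw [squareMeasure] at hi ⊢
  rw [integral_prod _ hi]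
  have : ∀ᵐ x ∂unitMeasure, ∫ y, crossProb (x, y) ^ k ∂unitMeasure =
      ∫ t in (0 : ℝ)..1, (2 * (t * (1 - t))) ^ k := by
    filter_upwards [ae_unitMeasure_mem] with x hx
    rw [← integral_comp_abs_sub (f := fun t => (2 * (t * (1 - t))) ^ k) (by fun_prop)
      (fun t => by ring) hx, ← integral_unitMeasure]
    refine integral_congr_ae (ae_unitMeasure_mem.mono fun y hy => ?_)
    simp only [crossProb_eq (p := (x, y)) hx hy]
  rw [integral_congr_ae this]
  simp

lemma variance_crossProb : Var[crossProb; squareMeasure] = 1 / 45 := by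
  rw [variance_eq_sub (memLp_two_of_bound measurable_crossProb abs_crossProb_le_one)]
  have h1 := integral_crossProb_pow 1
  have h2 := integral_crossProb_pow 2
  simp only [pow_one] at h1
  have hc : ∀ f : ℝ → ℝ, Continuous f → IntervalIntegrable f volume 0 1 := fun f hf =>
    hf.intervalIntegrable 0 1
  have e1 : ∫ t in (0 : ℝ)..1, 2 * (t * (1 - t)) = 1 / 3 := by
    have : ∀ t : ℝ, 2 * (t * (1 - t)) = 2 * t - 2 * t ^ 2 := fun t => by ring
    simp_rw [this]
    rw [intervalIntegral.integral_sub (hc _ (by fun_prop)) (hc _ (by fun_prop)),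
      intervalIntegral.integral_const_mul, integral_id]
    simp
    norm_num
  have e2 : ∫ t in (0 : ℝ)..1, (2 * (t * (1 - t))) ^ 2 = 2 / 15 := by
    have : ∀ t : ℝ, (2 * (t * (1 - t))) ^ 2 = 4 * t ^ 2 - 8 * t ^ 3 + 4 * t ^ 4 := fun t => by ring
    simp_rw [this]
    rw [intervalIntegral.integral_add (hc _ (by fun_prop)) (hc _ (by fun_prop)),
      intervalIntegral.integral_sub (hc _ (by fun_prop)) (hc _ (by fun_prop))]
    simp
    norm_num
  change ∫ p, crossProb p ^ 2 ∂squareMeasure - (∫ p, crossProb p ∂squareMeasure) ^ 2 = _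
  rw [h1, h2, e1, e2]
  norm_num

lemma measurable_endpoints {ι : Type*} (i : ι) : Measurable fun u : ι × Bool → ℝ => endpoints u i := by
  unfold endpoints
  fun_prop

lemma measurable_crossInd_endpoints {ι : Type*} (i j : ι) :
    Measurable fun u : ι × Bool → ℝ => crossInd (endpoints u i) (endpoints u j) :=
  measurable_crossInd.comp ((measurable_endpoints i).prodMk (measurable_endpoints j))

section

variable {ι : Type*} [Fintype ι]

lemma indepFun_of_endpoints {A B : Finset ι} (hAB : Disjoint A B) {f g : (ι × Bool → ℝ) → ℝ}
    (hf : Measurable f) (hg : Measurable g)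
    (hfA : ∀ u v, (∀ i ∈ A, endpoints u i = endpoints v i) → f u = f v)
    (hgB : ∀ u v, (∀ i ∈ B, endpoints u i = endpoints v i) → g u = g v) :
    IndepFun f g (endpointsMeasure ι) := by
  classical
  let ext : (S : Finset ι) → (↥(S ×ˢ (Finset.univ : Finset Bool)) → ℝ) → ι × Bool → ℝ :=
    fun S w a => if h : a ∈ S ×ˢ (Finset.univ : Finset Bool) then w ⟨a, h⟩ else 0
  have hext : ∀ S, Measurable (ext S) := fun S => by
    refine measurable_pi_lambda _ fun a => ?_
    by_cases h : a ∈ S ×ˢ (Finset.univ : Finset Bool)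
    · simpa only [ext, h, dif_pos] using measurable_pi_apply _
    · simpa only [ext, h, dif_neg, not_false_eq_true] using measurable_const
  have hend : ∀ (S : Finset ι) (u : ι × Bool → ℝ), ∀ i ∈ S,
      endpoints u i = endpoints (ext S fun a => u a) i := fun S u i hi => by
    simp [endpoints, ext, hi]
  have h := iIndepFun_eval.indepFun_finset (A ×ˢ (Finset.univ : Finset Bool))
    (B ×ˢ (Finset.univ : Finset Bool)) (Finset.disjoint_product.2 (Or.inl hAB))
    (fun a : ι × Bool => measurable_pi_apply a)
  have h' := h.comp (hf.comp (hext A)) (hg.comp (hext B))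
  convert h' using 1
  · ext u
    exact hfA _ _ (hend A u)
  · ext u
    exact hgB _ _ (hend B u)

lemma map_endpoints (i : ι) :
    (endpointsMeasure ι).map (fun u => endpoints u i) = squareMeasure :=
  map_eval_pair (by simp)

lemma map_endpoints_pair {i j : ι} (hij : i ≠ j) :
    (endpointsMeasure ι).map (fun u => (endpoints u i, endpoints u j)) =
      squareMeasure.prod squareMeasure := by
  have h : IndepFun (fun u : ι × Bool → ℝ => endpoints u i) (fun u => endpoints u j)
      (endpointsMeasure ι) :=
    iIndepFun_eval.indepFun_prodMk_prodMk (fun a => measurable_pi_apply a) _ _ _ _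
      (by simp [hij]) (by simp [hij]) (by simp [hij]) (by simp [hij])
  rw [indepFun_iff_map_prod_eq_prod_map_map (measurable_endpoints i).aemeasurable
    (measurable_endpoints j).aemeasurable] at h
  rw [h, map_endpoints, map_endpoints]

lemma integral_crossInd_mul {i j : ι} (hij : i ≠ j) {h : ℝ × ℝ → ℝ} (hm : Measurable h)
    (hb : ∀ p, |h p| ≤ 1) :
    ∫ u, crossInd (endpoints u i) (endpoints u j) * h (endpoints u i) ∂endpointsMeasure ι =
      ∫ p, crossProb p * h p ∂squareMeasure := by
  have hmeas : Measurable fun x : (ℝ × ℝ) × (ℝ × ℝ) => crossInd x.1 x.2 * h x.1 :=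
    measurable_crossInd.mul (hm.comp measurable_fst)
  rw [← integral_map (f := fun x : (ℝ × ℝ) × (ℝ × ℝ) => crossInd x.1 x.2 * h x.1)
    ((measurable_endpoints i).prodMk (measurable_endpoints j)).aemeasurable
    hmeas.aestronglyMeasurable, map_endpoints_pair hij, integral_prod]
  · simp_rw [integral_mul_const]
    rfl
  · refine Integrable.of_bound hmeas.aestronglyMeasurable 1 (Eventually.of_forall fun x => ?_)
    rw [Real.norm_eq_abs, abs_mul]
    exact mul_le_one₀ (abs_crossInd_le_one _ _) (abs_nonneg _) (hb _)

lemma memLp_crossInd_endpoints (i j : ι) :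
    MemLp (fun u => crossInd (endpoints u i) (endpoints u j)) 2 (endpointsMeasure ι) :=
  memLp_two_of_bound (measurable_crossInd_endpoints i j) fun _ => abs_crossInd_le_one _ _

lemma memLp_crossProb_endpoints (i : ι) :
    MemLp (fun u => crossProb (endpoints u i)) 2 (endpointsMeasure ι) :=
  memLp_two_of_bound (measurable_crossProb.comp (measurable_endpoints i)) fun _ =>
    abs_crossProb_le_one _

lemma variance_crossProb_endpoints (i : ι) :
    Var[fun u => crossProb (endpoints u i); endpointsMeasure ι] = 1 / 45 := by
  rw [← variance_crossProb, ← map_endpoints i, variance_map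
    measurable_crossProb.aemeasurable (measurable_endpoints i).aemeasurable]
  rfl

lemma covariance_crossInd_crossProb {i j : ι} (hij : i ≠ j) :
    cov[fun u => crossInd (endpoints u i) (endpoints u j), fun u => crossProb (endpoints u i);
      endpointsMeasure ι] = 1 / 45 := by
  rw [covariance_eq_sub (memLp_crossInd_endpoints i j) (memLp_crossProb_endpoints i),
    ← variance_crossProb,
    variance_eq_sub (memLp_two_of_bound measurable_crossProb abs_crossProb_le_one)]
  have h1 := integral_crossInd_mul hij measurable_crossProb abs_crossProb_le_one
  have h2 := integral_crossInd_mul hij (h := fun _ => 1) measurable_const (by simp)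
  have h3 : ∫ u, crossProb (endpoints u i) ∂endpointsMeasure ι =
      ∫ p, crossProb p ∂squareMeasure := by
    rw [← map_endpoints i, integral_map (measurable_endpoints i).aemeasurable
      measurable_crossProb.aestronglyMeasurable]
  simp only [mul_one] at h2
  simp only [Pi.mul_apply, Pi.pow_apply, sq]
  rw [h1, h2, h3]

lemma covariance_crossInd_crossProb_eq_zero {i j k : ι} (hi : k ≠ i) (hj : k ≠ j) :
    cov[fun u => crossInd (endpoints u i) (endpoints u j), fun u => crossProb (endpoints u k);
      endpointsMeasure ι] = 0 := by
  classical
  refine (indepFun_of_endpoints (A := {i, j}) (B := {k}) (by simp [hi, hj])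
    (measurable_crossInd_endpoints i j) (measurable_crossProb.comp (measurable_endpoints k))
    ?_ ?_).covariance_eq_zero (memLp_crossInd_endpoints i j) (memLp_crossProb_endpoints k)
  · intro u v h
    simp only [Finset.mem_insert, Finset.mem_singleton, forall_eq_or_imp, forall_eq] at h
    rw [h.1, h.2]
  · intro u v h
    simp only [Finset.mem_singleton, forall_eq] at h
    simp only [Function.comp_apply, h]

lemma cast_crossCount (u : ι × Bool → ℝ) :
    (crossCount u : ℝ) = ∑ p : ι × ι, crossInd (endpoints u p.1) (endpoints u p.2) / 2 := by
  have h : (crossCount u : ℝ) =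
      ∑ p : ι × ι, if Interleaved (endpoints u p.1) (endpoints u p.2) then (1 : ℝ) else 0 := by
    simp [crossCount]
  have h' : (crossCount u : ℝ) =
      ∑ p : ι × ι, if Interleaved (endpoints u p.2) (endpoints u p.1) then (1 : ℝ) else 0 := by
    rw [h, ← (Equiv.prodComm ι ι).sum_comp]
    rfl
  rw [← Finset.sum_div]
  simp only [crossInd, Finset.sum_add_distrib]
  rw [← h, ← h']
  ring

lemma sum_covariance_crossInd_crossProb [DecidableEq ι] (i j : ι) :
    ∑ k, cov[fun u => crossInd (endpoints u i) (endpoints u j) / 2,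
      fun u => crossProb (endpoints u k); endpointsMeasure ι] = if i = j then 0 else 1 / 45 := by
  simp_rw [covariance_fun_div_left]
  split_ifs with hij
  · subst hij
    simp [crossInd_self]
  · rw [← Finset.sum_subset (Finset.subset_univ {i, j}) fun k _ hk => by
      simp only [Finset.mem_insert, Finset.mem_singleton, not_or] at hk
      rw [covariance_crossInd_crossProb_eq_zero hk.1 hk.2, zero_div], Finset.sum_pair hij,
      covariance_crossInd_crossProb hij]
    simp_rw [crossInd_comm (endpoints _ i)]
    rw [covariance_crossInd_crossProb (Ne.symm hij)]
    norm_num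

theorem le_variance_crossCount :
    ((Fintype.card ι : ℝ) * ((Fintype.card ι : ℝ) - 1) ^ 2) / 45 ≤
    Var[fun u => (crossCount u : ℝ); endpointsMeasure ι] := by
  classical
  set n : ℝ := (Fintype.card ι : ℝ) with hn
  set X : (ι × Bool → ℝ) → ℝ := fun u => crossCount u with hX
  set L : (ι × Bool → ℝ) → ℝ := fun u => ∑ k, crossProb (endpoints u k) with hL
  have hψ : ∀ p : ι × ι, MemLp (fun u => crossInd (endpoints u p.1) (endpoints u p.2) / 2) 2
      (endpointsMeasure ι) := fun p => by
    simpa only [div_eq_mul_inv] using (memLp_crossInd_endpoints p.1 p.2).mul_const 2⁻¹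
  have hXe : X = fun u => ∑ p : ι × ι, crossInd (endpoints u p.1) (endpoints u p.2) / 2 :=
    funext cast_crossCount
  have hXL : MemLp X 2 (endpointsMeasure ι) := by
    rw [hXe]
    exact memLp_finsetSum _ fun p _ => hψ p
  have hLL : MemLp L 2 (endpointsMeasure ι) :=
    memLp_finsetSum _ fun k _ => memLp_crossProb_endpoints k
  have hcov : cov[X, L; endpointsMeasure ι] = n * (n - 1) / 45 := by
    rw [hXe, covariance_fun_sum_fun_sum hψ memLp_crossProb_endpoints]
    simp_rw [sum_covariance_crossInd_crossProb]
    rw [Fintype.sum_prod_type]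
    have : ∀ i : ι, ∑ j, (if i = j then 0 else 1 / 45 : ℝ) = (n - 1) / 45 := fun i => by
      have h : ∀ j : ι, (if i = j then 0 else 1 / 45 : ℝ) = 1 / 45 - if i = j then 1 / 45 else 0 :=
        fun j => by split_ifs <;> ring
      simp_rw [h, Finset.sum_sub_distrib]
      simp [← hn]
      ring
    simp_rw [this]
    simp [← hn]
    ring
  have hvar : Var[L; endpointsMeasure ι] = n / 45 := by
    have : L = ∑ k, fun u => crossProb (endpoints u k) := by
      ext u
      simp [hL]
    rw [this, IndepFun.variance_sum (fun k _ => memLp_crossProb_endpoints k)]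
    · simp_rw [variance_crossProb_endpoints]
      simp [← hn]
      ring
    · intro i _ j _ hij
      refine indepFun_of_endpoints (A := {i}) (B := {j}) (by simpa using hij)
        (measurable_crossProb.comp (measurable_endpoints i))
        (measurable_crossProb.comp (measurable_endpoints j)) ?_ ?_ <;>
      · intro u v h
        simp only [Finset.mem_singleton, forall_eq] at h
        simp only [h]
  have h := variance_nonneg (fun u => X u - (n - 1) * L u) (endpointsMeasure ι)
  rw [variance_fun_sub hXL (hLL.const_mul _), variance_const_mul, covariance_const_mul_right,
    hcov, hvar] at h
  linarith

end

/-! ### Normal approximation of the number of crossings -/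

/-- The pairs of chords sharing a chord with a given pair. -/
def sharingPairs {ι : Type*} [Fintype ι] [DecidableEq ι] (e : ι × ι) : Finset (ι × ι) :=
  Finset.univ.filter fun q => q.1 = e.1 ∨ q.1 = e.2 ∨ q.2 = e.1 ∨ q.2 = e.2

lemma card_sharingPairs_le {ι : Type*} [Fintype ι] [DecidableEq ι] (e : ι × ι) :
    (sharingPairs e).card ≤ 4 * Fintype.card ι := by
  have h : sharingPairs e ⊆ ({e.1, e.2} ×ˢ Finset.univ) ∪ (Finset.univ ×ˢ {e.1, e.2}) := by
    intro q hq
    simp only [sharingPairs, Finset.mem_filter, Finset.mem_univ, true_and] at hq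
    simp only [Finset.mem_union, Finset.mem_product, Finset.mem_insert, Finset.mem_singleton,
      Finset.mem_univ, and_true, true_and]
    tauto
  calc _ ≤ _ := Finset.card_le_card h
    _ ≤ _ := Finset.card_union_le _ _
    _ = ({e.1, e.2} : Finset ι).card * Fintype.card ι +
        Fintype.card ι * ({e.1, e.2} : Finset ι).card := by
      rw [Finset.card_product, Finset.card_product, Finset.card_univ]
    _ ≤ 2 * Fintype.card ι + Fintype.card ι * 2 := by gcongr <;> exact Finset.card_le_two
    _ = _ := by ring

/-- The centred contribution of a pair of chords to the number of crossings, divided by `σ`. -/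
noncomputable def pairSummand {ι : Type*} [Fintype ι] (σ : ℝ) (p : ι × ι) (u : ι × Bool → ℝ) : ℝ :=
  (crossInd (endpoints u p.1) (endpoints u p.2) / 2 -
    ∫ v, crossInd (endpoints v p.1) (endpoints v p.2) / 2 ∂endpointsMeasure ι) / σ

section

variable {ι : Type*} [Fintype ι]

lemma measurable_pairSummand (σ : ℝ) (p : ι × ι) : Measurable (pairSummand σ p) :=
  (((measurable_crossInd_endpoints p.1 p.2).div_const 2).sub_const _).div_const σ

lemma integrable_crossInd_endpoints_div (p : ι × ι) :
    Integrable (fun u => crossInd (endpoints u p.1) (endpoints u p.2) / 2)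
      (endpointsMeasure ι) :=
  ((memLp_crossInd_endpoints p.1 p.2).integrable (by norm_num)).div_const 2

lemma pairSummand_congr (σ : ℝ) (p : ι × ι) {u v : ι × Bool → ℝ}
    (h1 : endpoints u p.1 = endpoints v p.1) (h2 : endpoints u p.2 = endpoints v p.2) :
    pairSummand σ p u = pairSummand σ p v := by
  unfold pairSummand
  rw [h1, h2]

lemma abs_pairSummand_le {σ : ℝ} (hσ : 0 < σ) (p : ι × ι) (u : ι × Bool → ℝ) :
    |pairSummand σ p u| ≤ 1 / (2 * σ) := by
  have h0 : ∀ v : ι × Bool → ℝ, 0 ≤ crossInd (endpoints v p.1) (endpoints v p.2) / 2 :=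
    fun v => div_nonneg (crossInd_nonneg _ _) (by norm_num)
  have h1 : ∀ v : ι × Bool → ℝ, crossInd (endpoints v p.1) (endpoints v p.2) / 2 ≤ 1 / 2 :=
    fun v => by gcongr; exact crossInd_le_one _ _
  have hi0 : 0 ≤ ∫ v, crossInd (endpoints v p.1) (endpoints v p.2) / 2 ∂endpointsMeasure ι :=
    integral_nonneg h0
  have hi1 : ∫ v, crossInd (endpoints v p.1) (endpoints v p.2) / 2 ∂endpointsMeasure ι ≤ 1 / 2 := by
    calc _ ≤ ∫ _, (1 / 2 : ℝ) ∂endpointsMeasure ι :=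
          integral_mono (integrable_crossInd_endpoints_div p) (integrable_const _) h1
      _ = _ := by simp
  rw [pairSummand, abs_div, abs_of_pos hσ, ← div_div]
  gcongr
  rw [abs_le]
  constructor <;> linarith [h0 u, h1 u]

lemma integral_pairSummand (σ : ℝ) (p : ι × ι) :
    ∫ u, pairSummand σ p u ∂endpointsMeasure ι = 0 := by
  unfold pairSummand
  rw [integral_div, integral_sub (integrable_crossInd_endpoints_div p) (integrable_const _)]
  simp

lemma sum_pairSummand (σ : ℝ) (u : ι × Bool → ℝ) :
    ∑ p, pairSummand σ p u =
      ((crossCount u : ℝ) - ∫ v, (crossCount v : ℝ) ∂endpointsMeasure ι) / σ := by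
  simp_rw [cast_crossCount]
  rw [integral_finsetSum _ fun p _ => integrable_crossInd_endpoints_div p,
    ← Finset.sum_sub_distrib, Finset.sum_div]
  rfl

lemma measurable_cast_crossCount : Measurable fun u : ι × Bool → ℝ => (crossCount u : ℝ) := by
  simp_rw [cast_crossCount]
  exact Finset.measurable_fun_sum _ fun p _ => (measurable_crossInd_endpoints p.1 p.2).div_const 2

theorem locallyDependent_pairSummand [DecidableEq ι]
    (hσ : 0 < Var[fun u => (crossCount u : ℝ); endpointsMeasure ι]) :
    LocallyDependent (endpointsMeasure ι) sharingPairs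
      (pairSummand √(Var[fun u => (crossCount u : ℝ); endpointsMeasure ι]))
      (1 / (2 * √(Var[fun u => (crossCount u : ℝ); endpointsMeasure ι])))
      (4 * Fintype.card ι) where
  measurable := measurable_pairSummand _
  bound := abs_pairSummand_le (Real.sqrt_pos.2 hσ)
  mean_zero := integral_pairSummand _
  second_moment := by
    simp_rw [sum_pairSummand, div_pow, Real.sq_sqrt hσ.le]
    rw [integral_div, ← variance_eq_integral measurable_cast_crossCount.aemeasurable,
      div_self hσ.ne']
  card_nbr := card_sharingPairs_le
  symm e g h := by
    simp only [sharingPairs, Finset.mem_filter, Finset.mem_univ, true_and] at h ⊢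
    tauto
  indep_sum e := by
    refine indepFun_of_endpoints (A := {e.1, e.2}) (B := {e.1, e.2}ᶜ) disjoint_compl_right
      (measurable_pairSummand _ _)
      (Finset.measurable_fun_sum _ fun p _ => measurable_pairSummand _ p) ?_ ?_
    · intro u v h
      exact pairSummand_congr _ _ (h _ (by simp)) (h _ (by simp))
    · intro u v h
      refine Finset.sum_congr rfl fun g hg => ?_
      simp only [sharingPairs, Finset.mem_compl, Finset.mem_filter, Finset.mem_univ, true_and,
        not_or] at hg
      exact pairSummand_congr _ _ (h _ (by simp [hg])) (h _ (by simp [hg]))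
  indep_mul e g e' g' he hg := by
    simp only [sharingPairs, Finset.mem_union, Finset.mem_filter, Finset.mem_univ, true_and,
      not_or] at he hg
    refine indepFun_of_endpoints (A := {e.1, e.2, g.1, g.2}) (B := {e'.1, e'.2, g'.1, g'.2}) ?_
      ((measurable_pairSummand _ _).mul (measurable_pairSummand _ _))
      ((measurable_pairSummand _ _).mul (measurable_pairSummand _ _)) ?_ ?_
    · simp only [Finset.disjoint_right, Finset.mem_insert, Finset.mem_singleton]
      rintro i (rfl | rfl | rfl | rfl) <;> tauto
    · intro u v h
      rw [pairSummand_congr _ e (h _ (by simp)) (h _ (by simp)),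
        pairSummand_congr _ g (h _ (by simp)) (h _ (by simp))]
    · intro u v h
      rw [pairSummand_congr _ e' (h _ (by simp)) (h _ (by simp)),
        pairSummand_congr _ g' (h _ (by simp)) (h _ (by simp))]

end

lemma normal_approximation_error_le {n σ : ℝ} (hn : 40 ≤ n) (hσ : 0 < σ)
    (h : n * (n - 1) ^ 2 / 45 ≤ σ ^ 2) :
    4 * √(8 * (n * n) * (4 * n) ^ 3 * (1 / (2 * σ)) ^ 4) +
      12 * (n * n) * (4 * n) ^ 2 * (1 / (2 * σ)) ^ 3 + 4 * n * (1 / (2 * σ)) ≤ 12920 / √n := by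
  set s := √n with hs
  have hs0 : 0 < s := Real.sqrt_pos.2 (by linarith)
  have hsn : n = s ^ 2 := (Real.sq_sqrt (by linarith)).symm
  have hσ2 : s ^ 6 / 50 ≤ σ ^ 2 := by
    refine le_trans ?_ h
    have h1 : n ^ 2 * 45 ≤ (n - 1) ^ 2 * 50 := by nlinarith
    have : s ^ 6 = n * n ^ 2 := by rw [hsn]; ring
    rw [this, div_le_div_iff₀ (by norm_num) (by norm_num), mul_assoc, mul_assoc]
    exact mul_le_mul_of_nonneg_left h1 (by linarith)
  have hσ1 : s ^ 3 / 7.1 ≤ σ := by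
    refine (sq_le_sq₀ (by positivity) hσ.le).1 ?_
    rw [div_pow]
    calc (s ^ 3) ^ 2 / 7.1 ^ 2 ≤ s ^ 6 / 50 := by
          rw [← pow_mul]; gcongr; norm_num
      _ ≤ _ := hσ2
  have hinv : 1 / (2 * σ) ≤ 3.55 / s ^ 3 := by
    rw [div_le_div_iff₀ (by positivity) (by positivity)]
    rw [div_le_iff₀ (by norm_num)] at hσ1
    linarith
  have hs1 : 1 ≤ s := by rw [hs, Real.one_le_sqrt]; linarith
  have hsqrt : √(8 * (n * n) * (4 * n) ^ 3 * (1 / (2 * σ)) ^ 4) ≤ 23 * 3.55 ^ 2 / s := by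
    refine Real.sqrt_le_iff.2 ⟨by positivity, ?_⟩
    calc _ ≤ 8 * (n * n) * (4 * n) ^ 3 * (3.55 / s ^ 3) ^ 4 := by
          have : 0 ≤ n := by linarith
          gcongr
      _ = 512 * 3.55 ^ 4 / s ^ 2 := by rw [hsn]; field_simp; ring
      _ ≤ _ := by
          rw [div_pow]; gcongr; norm_num
  have h2 : 12 * (n * n) * (4 * n) ^ 2 * (1 / (2 * σ)) ^ 3 ≤ 192 * 3.55 ^ 3 / s := by
    calc _ ≤ 12 * (n * n) * (4 * n) ^ 2 * (3.55 / s ^ 3) ^ 3 := by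
          have : 0 ≤ n := by linarith
          gcongr
      _ = _ := by rw [hsn]; field_simp; ring
  have h3 : 4 * n * (1 / (2 * σ)) ≤ 4 * 3.55 / s := by
    calc _ ≤ 4 * n * (3.55 / s ^ 3) := by
          have : 0 ≤ n := by linarith
          gcongr
      _ = _ := by rw [hsn]; field_simp
  calc _ ≤ 4 * (23 * 3.55 ^ 2 / s) + 192 * 3.55 ^ 3 / s + 4 * 3.55 / s := by gcongr
    _ = (4 * (23 * 3.55 ^ 2) + 192 * 3.55 ^ 3 + 4 * 3.55) / s := by ring
    _ ≤ _ := by gcongr; norm_num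

theorem abs_cdf_crossCount_sub_le {n : ℕ} (hn : 40 ≤ n) (z : ℝ) :
    |(endpointsMeasure (Fin n)).real {u | ((crossCount u : ℝ) -
        ∫ v, (crossCount v : ℝ) ∂endpointsMeasure (Fin n)) /
        √(Var[fun u => (crossCount u : ℝ); endpointsMeasure (Fin n)]) ≤ z} -
      (gaussianReal 0 1).real (Set.Iic z)| ≤ 12920 / √n := by
  have hv := le_variance_crossCount (ι := Fin n)
  rw [Fintype.card_fin] at hv
  have hn' : (40 : ℝ) ≤ n := by exact_mod_cast hn
  have hpos : 0 < Var[fun u => (crossCount u : ℝ); endpointsMeasure (Fin n)] := by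
    refine lt_of_lt_of_le ?_ hv
    have : (0 : ℝ) < n - 1 := by linarith
    positivity
  have hσ := Real.sqrt_pos.2 hpos
  have h := (locallyDependent_pairSummand hpos).abs_cdf_sub_le (by positivity)
    (by rw [Fintype.card_fin]; lia) (by rw [Fintype.card_prod, Fintype.card_fin]; positivity) z
  simp_rw [sum_pairSummand] at h
  refine h.trans ?_
  rw [Fintype.card_prod, Fintype.card_fin]
  push_cast
  exact normal_approximation_error_le hn' hσ (by rwa [Real.sq_sqrt hpos.le])

lemma isProbabilityMeasure_uniformCD (n : ℕ) : IsProbabilityMeasure (uniformCD n) := by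
  have h := integral_comp_crossings_uniformCD n fun _ => 1
  simp only [integral_const, smul_eq_mul, mul_one, probReal_univ] at h
  exact ⟨by rw [← ENNReal.toReal_eq_one_iff]; exact h⟩

/-- Theorem 1 (crossings CLT with rate): for `n ≥ 2`, the Kolmogorov distance between the
standardized number of crossings and a standard normal is at most `12920 / √n`. -/
theorem crossings_kolmogorov_bound (n : ℕ) (hn : 2 ≤ n) (μn σn : ℝ)
    (hμ : μn = ∫ π, ((crossings π : ℝ)) ∂uniformCD n)
    (hσ : σn = Real.sqrt (variance (fun π => (crossings π : ℝ)) (uniformCD n)))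
    (x : ℝ) :
    |((uniformCD n) {π | ((crossings π : ℝ) - μn) / σn ≤ x}).toReal -
        ((gaussianReal 0 1) (Set.Iic x)).toReal| ≤ 12920 / Real.sqrt n := by
  have := isProbabilityMeasure_uniformCD n
  rcases lt_or_ge n 40 with hn40 | hn40
  · have h1 : √n ≤ 12920 := by
      rw [Real.sqrt_le_iff]
      have : (n : ℝ) < 40 := by exact_mod_cast hn40
      constructor <;> linarith
    have h0 : 0 < √n := Real.sqrt_pos.2 (by positivity)
    refine le_trans ?_ ((one_le_div h0).2 h1)
    change |(uniformCD n).real _ - (gaussianReal 0 1).real _| ≤ 1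
    rw [abs_le]
    constructor <;> linarith [measureReal_nonneg (μ := uniformCD n)
        (s := {π | ((crossings π : ℝ) - μn) / σn ≤ x}),
      measureReal_le_one (μ := uniformCD n) (s := {π | ((crossings π : ℝ) - μn) / σn ≤ x}),
      measureReal_nonneg (μ := gaussianReal 0 1) (s := Set.Iic x),
      measureReal_le_one (μ := gaussianReal 0 1) (s := Set.Iic x)]
  have hμ' : μn = ∫ u, (crossCount u : ℝ) ∂endpointsMeasure (Fin n) := by
    rw [hμ, integral_comp_crossings_uniformCD n fun k => (k : ℝ)]
  have hσ' : σn = √(Var[fun u => (crossCount u : ℝ); endpointsMeasure (Fin n)]) := by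
    rw [hσ, variance_eq_integral (measurable_of_finite _).aemeasurable, ← hμ,
      integral_comp_crossings_uniformCD n fun k => ((k : ℝ) - μn) ^ 2,
      variance_eq_integral measurable_cast_crossCount.aemeasurable, ← hμ']
  have hcdf : (uniformCD n).real {π | ((crossings π : ℝ) - μn) / σn ≤ x} =
      (endpointsMeasure (Fin n)).real {u | ((crossCount u : ℝ) - μn) / σn ≤ x} := by
    have h := integral_comp_crossings_uniformCD n
      (Set.indicator {k : ℕ | ((k : ℝ) - μn) / σn ≤ x} 1)
    have hm : MeasurableSet {u : Fin n × Bool → ℝ | ((crossCount u : ℝ) - μn) / σn ≤ x} :=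
      measurableSet_le ((measurable_cast_crossCount.sub_const _).div_const _) measurable_const
    rw [← integral_indicator_one (Set.toFinite _).measurableSet, ← integral_indicator_one hm]
    exact h
  change |(uniformCD n).real _ - (gaussianReal 0 1).real _| ≤ _
  rw [hcdf, hμ', hσ']
  exact abs_cdf_crossCount_sub_le hn40 x
end

section
/- Let $S_n$ be the number of simple chords in a uniformly random chord diagram of size $n$ and let $Y$ be a Poisson random variable with mean $1$. Then the total variation distance satisfies $d_{TV}(S_n, Y) = O(1/n)$. -/
open MeasureTheory ProbabilityTheory Filter
open scoped Nat

open Equiv Finset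

section
variable {α : Type*} [Fintype α] [DecidableEq α]

/-- The fixed-point-free involutions of a finite type. -/
def fpfInvolutions (α : Type*) [Fintype α] [DecidableEq α] : Finset (Perm α) :=
  univ.filter fun π => (∀ i, π (π i) = i) ∧ ∀ i, π i ≠ i

/-- The number of points at which two permutations agree. -/
def agreements (σ π : Perm α) : ℕ := (univ.filter fun k => π k = σ k).card

/-- Rematch `k` with `l`, and their former partners with each other. -/
def rematch (k l : α) (π : Perm α) : Perm α := swap l (π k) * π * swap l (π k)

lemma mem_fpfInvolutions {π : Perm α} :
    π ∈ fpfInvolutions α ↔ (∀ i, π (π i) = i) ∧ ∀ i, π i ≠ i := by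
  simp [fpfInvolutions]

lemma conj_swap_mem_fpfInvolutions {π : Perm α} (h : π ∈ fpfInvolutions α) (a b : α) :
    swap a b * π * swap a b ∈ fpfInvolutions α := by
  rw [mem_fpfInvolutions] at *
  refine ⟨fun i => by simp [h.1], fun i hi => h.2 (swap a b i) ?_⟩
  rw [← swap_apply_self a b (π (swap a b i))]
  exact congrArg _ hi

omit [Fintype α] in
lemma conj_swap_conj_swap (π : Perm α) (a b : α) :
    swap a b * (swap a b * π * swap a b) * swap a b = π := by
  ext i; simp

lemma sum_conj_swap {k l a : α} (hl : l ≠ k) (ha : a ≠ k) (F : Perm α → ℝ) :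
    ∑ π ∈ (fpfInvolutions α).filter (fun π => π k = a), F (swap l a * π * swap l a) =
      ∑ π ∈ (fpfInvolutions α).filter (fun π => π k = l), F π := by
  refine sum_nbij' (fun π => swap l a * π * swap l a) (fun π => swap l a * π * swap l a)
    ?_ ?_ ?_ ?_ ?_
  · intro π hπ
    rw [mem_filter] at *
    refine ⟨conj_swap_mem_fpfInvolutions hπ.1 _ _, ?_⟩
    simp [swap_apply_of_ne_of_ne hl.symm ha.symm, hπ.2]
  · intro π hπ
    rw [mem_filter] at *
    refine ⟨conj_swap_mem_fpfInvolutions hπ.1 _ _, ?_⟩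
    simp [swap_apply_of_ne_of_ne hl.symm ha.symm, hπ.2]
  · intro π _; exact conj_swap_conj_swap π l a
  · intro π _; exact conj_swap_conj_swap π l a
  · intro π _; rfl

lemma sum_rematch {k l : α} (hl : l ≠ k) (F : Perm α → ℝ) :
    ∑ π ∈ fpfInvolutions α, F (rematch k l π) =
      (Fintype.card α - 1) * ∑ π ∈ (fpfInvolutions α).filter (fun π => π k = l), F π := by
  rw [← sum_fiberwise (fpfInvolutions α) (fun π => π k)]
  have h : ∀ a ∈ univ.erase k, ∑ π ∈ (fpfInvolutions α).filter (fun π => π k = a),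
      F (rematch k l π) = ∑ π ∈ (fpfInvolutions α).filter (fun π => π k = l), F π := by
    intro a ha
    rw [← sum_conj_swap hl (ne_of_mem_erase ha)]
    refine sum_congr rfl fun π hπ => ?_
    rw [rematch, (mem_filter.1 hπ).2]
  have h0 : ∑ π ∈ (fpfInvolutions α).filter (fun π => π k = k), F (rematch k l π) = 0 := by
    rw [filter_false_of_mem, sum_empty]
    intro π hπ
    exact (mem_fpfInvolutions.1 hπ).2 k
  rw [← add_sum_erase univ _ (mem_univ k), h0, sum_congr rfl h, sum_const, zero_add,
    card_erase_of_mem (mem_univ k), card_univ, nsmul_eq_mul,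
    Nat.cast_sub (Fintype.card_pos_iff.2 ⟨k⟩), Nat.cast_one]

lemma card_filter_apply_eq_le (k l : α) :
    ((Fintype.card α : ℝ) - 1) * ((fpfInvolutions α).filter (fun π => π k = l)).card ≤
      (fpfInvolutions α).card := by
  rcases eq_or_ne l k with rfl | hl
  · rw [filter_false_of_mem fun π hπ => (mem_fpfInvolutions.1 hπ).2 l]
    simp
  · have := sum_rematch hl (fun _ => 1)
    simp only [sum_const, nsmul_eq_mul, mul_one] at this
    exact this.ge

lemma card_filter_apply_apply_eq {k l a c c' : α} (hck : c ≠ k) (hcl : c ≠ l) (hca : c ≠ a)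
    (hck' : c' ≠ k) (hcl' : c' ≠ l) (hca' : c' ≠ a) :
    ((fpfInvolutions α).filter (fun π => π k = a ∧ π l = c)).card =
      ((fpfInvolutions α).filter (fun π => π k = a ∧ π l = c')).card := by
  refine card_nbij' (fun π => swap c c' * π * swap c c') (fun π => swap c c' * π * swap c c')
    ?_ ?_ (fun π _ => conj_swap_conj_swap π c c') (fun π _ => conj_swap_conj_swap π c c')
  all_goals
    intro π hπ
    rw [mem_coe, mem_filter] at *
    refine ⟨conj_swap_mem_fpfInvolutions hπ.1 _ _, ?_, ?_⟩
    · simp [swap_apply_of_ne_of_ne hck.symm hck'.symm, hπ.2,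
        swap_apply_of_ne_of_ne hca.symm hca'.symm]
    · simp [swap_apply_of_ne_of_ne hcl.symm hcl'.symm, hπ.2]

lemma card_filter_apply_apply_le {k l a c : α} (hck : c ≠ k) (hcl : c ≠ l) (hca : c ≠ a) :
    ((Fintype.card α : ℝ) - 3) *
      ((fpfInvolutions α).filter (fun π => π k = a ∧ π l = c)).card ≤
      ((fpfInvolutions α).filter (fun π => π k = a)).card := by
  have h1 : ∑ c' ∈ univ \ {k, l, a},
      ((fpfInvolutions α).filter (fun π => π k = a ∧ π l = c')).card ≤
      ((fpfInvolutions α).filter (fun π => π k = a)).card := by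
    rw [card_eq_sum_card_fiberwise (f := fun π : Perm α => π l) (t := univ) (by simp)]
    simp_rw [filter_filter]
    exact sum_le_sum_of_subset (subset_univ _)
  rw [sum_congr rfl (g := fun _ => ((fpfInvolutions α).filter
    (fun π => π k = a ∧ π l = c)).card), sum_const, smul_eq_mul] at h1
  · have h2 : Fintype.card α ≤ (univ \ {k, l, a} : Finset α).card + 3 := by
      have := le_card_sdiff {k, l, a} (univ : Finset α)
      have := card_le_three (a := k) (b := l) (c := a)
      rw [card_univ] at *
      omega
    have h1' : ((univ \ {k, l, a} : Finset α).card : ℝ) *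
      ((fpfInvolutions α).filter (fun π => π k = a ∧ π l = c)).card ≤
      ((fpfInvolutions α).filter (fun π => π k = a)).card := by exact_mod_cast h1
    have h2' : (Fintype.card α : ℝ) ≤ (univ \ {k, l, a} : Finset α).card + 3 := by
      exact_mod_cast h2
    refine le_trans ?_ h1'
    gcongr
    linarith
  · intro c' hc'
    simp only [Finset.mem_sdiff, mem_univ, mem_insert, mem_singleton, true_and, not_or] at hc'
    exact card_filter_apply_apply_eq hc'.1 hc'.2.1 hc'.2.2 hck hcl hca

lemma card_filter_apply_eq_comp_le {k l : α} (hl : l ≠ k) (g : α → α) :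
    ((Fintype.card α : ℝ) - 3) *
      ((fpfInvolutions α).filter (fun π => π k ≠ l ∧ π l = g (π k))).card ≤
      (fpfInvolutions α).card := by
  rw [card_eq_sum_card_fiberwise (f := fun π : Perm α => π k) (t := univ) (by simp),
    card_eq_sum_card_fiberwise (s := fpfInvolutions α) (f := fun π : Perm α => π k)
      (t := univ) (by simp)]
  push_cast
  rw [mul_sum]
  refine sum_le_sum fun a _ => ?_
  rw [filter_filter]
  rcases ((fpfInvolutions α).filter
    (fun π => (π k ≠ l ∧ π l = g (π k)) ∧ π k = a)).eq_empty_or_nonempty with h | ⟨π, hπ⟩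
  · rw [h]; simp
  · rw [mem_filter, mem_fpfInvolutions] at hπ
    obtain ⟨⟨h1, h2⟩, ⟨h3, h4⟩, h5⟩ := hπ
    rw [h5] at h3 h4
    have e : (fpfInvolutions α).filter (fun π => (π k ≠ l ∧ π l = g (π k)) ∧ π k = a) =
        (fpfInvolutions α).filter (fun π => π k = a ∧ π l = g a) := by
      refine filter_congr fun ρ _ => ⟨?_, ?_⟩
      · rintro ⟨⟨_, h⟩, rfl⟩; exact ⟨rfl, h⟩
      · rintro ⟨rfl, h⟩; exact ⟨⟨h3, h⟩, rfl⟩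
    rw [e]
    apply card_filter_apply_apply_le
    · intro h; rw [← h4] at h; apply h3; rw [← h5, ← h, h1]
    · intro h; exact h2 l (h4.trans h)
    · intro h; rw [← h5, h5, ← h4, ← h5] at h; exact hl (π.injective h)

lemma agreements_rematch {σ π : Perm α} (hσ : ∀ i, σ i ≠ i) (hσ' : ∀ i, σ (σ i) ≠ i)
    (hπ : π ∈ fpfInvolutions α) {k : α} (h1 : π k ≠ σ k) (h2 : π (σ k) ≠ σ (σ k))
    (h3 : π k ≠ σ.symm k) (h4 : π (σ k) ≠ σ (π k)) (h5 : π (σ k) ≠ σ.symm (π k)) :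
    agreements σ (rematch k (σ k) π) = agreements σ π + 1 := by
  rw [mem_fpfInvolutions] at hπ
  obtain ⟨hi, hf⟩ := hπ
  rw [ne_eq, Equiv.eq_symm_apply] at h3 h5
  unfold agreements
  rw [← card_insert_of_notMem (a := k) (by simpa using h1)]
  congr 1
  ext j
  have key : ∀ i j, π i = j ↔ π j = i := fun i j =>
    ⟨fun h => by rw [← h, hi], fun h => by rw [← h, hi]⟩
  simp only [mem_filter, mem_univ, true_and, mem_insert]
  simp only [rematch, Perm.mul_apply]
  have hkj := hσ k
  have hf1 := hf k
  by_cases c1 : j = k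
  · subst c1
    simp [swap_apply_of_ne_of_ne (hσ j).symm (hf j).symm]
  by_cases c2 : j = σ k
  · subst c2
    have := hσ' k
    simp [hi, swap_apply_of_ne_of_ne (hσ k).symm (hf k).symm, hσ k, h2, this.symm]
  by_cases c3 : j = π k
  · subst c3
    have e : swap (σ k) (π k) (π (σ k)) = π (σ k) :=
      swap_apply_of_ne_of_ne (hf _) (fun h => hkj (π.injective h))
    simp [e, hi, h4, hf k, Ne.symm h3]
  by_cases c4 : j = π (σ k)
  · subst c4
    rw [swap_apply_of_ne_of_ne c2 c3, hi, swap_apply_left]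
    simp [c1, Ne.symm h5, Ne.symm c1]
  · rw [swap_apply_of_ne_of_ne c2 c3, swap_apply_of_ne_of_ne]
    · simp [c1]
    · exact fun h => c4 ((key _ _).1 h).symm
    · exact fun h => c1 (π.injective h)

lemma card_filter_agreements_rematch_ne_le {σ : Perm α} (hσ : ∀ i, σ i ≠ i)
    (hσ' : ∀ i, σ (σ i) ≠ i) (hα : 3 < Fintype.card α) (k : α) :
    (((fpfInvolutions α).filter (fun π =>
      agreements σ (rematch k (σ k) π) ≠ agreements σ π + 1)).card : ℝ) ≤
      (3 / (Fintype.card α - 1) + 2 / (Fintype.card α - 3)) * (fpfInvolutions α).card := by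
  have hα' : (3 : ℝ) < Fintype.card α := by exact_mod_cast hα
  have hsub : (fpfInvolutions α).filter (fun π =>
      agreements σ (rematch k (σ k) π) ≠ agreements σ π + 1) ⊆
      (fpfInvolutions α).filter (fun π => π k = σ k) ∪
      (fpfInvolutions α).filter (fun π => π (σ k) = σ (σ k)) ∪
      (fpfInvolutions α).filter (fun π => π k = σ.symm k) ∪
      (fpfInvolutions α).filter (fun π => π k ≠ σ k ∧ π (σ k) = σ (π k)) ∪
      (fpfInvolutions α).filter (fun π => π k ≠ σ k ∧ π (σ k) = σ.symm (π k)) := by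
    intro π hπ
    obtain ⟨hD, hne⟩ := mem_filter.1 hπ
    simp only [mem_union, mem_filter, hD, true_and]
    by_contra! H
    exact hne (agreements_rematch hσ hσ' hD (by tauto) (by tauto) (by tauto) (by tauto) (by tauto))
  have hcard := (card_le_card hsub).trans ((card_union_le _ _).trans (Nat.add_le_add_right
    ((card_union_le _ _).trans (Nat.add_le_add_right ((card_union_le _ _).trans
      (Nat.add_le_add_right (card_union_le _ _) _)) _)) _))
  have hcard' := (Nat.cast_le (α := ℝ)).2 hcard
  push_cast at hcard'
  have one_point (a b : α) : (((fpfInvolutions α).filter (fun π => π a = b)).card : ℝ) ≤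
      (fpfInvolutions α).card / (Fintype.card α - 1) := by
    rw [le_div_iff₀' (by linarith)]
    exact card_filter_apply_eq_le a b
  have two_points (g : α → α) :
      (((fpfInvolutions α).filter (fun π => π k ≠ σ k ∧ π (σ k) = g (π k))).card : ℝ) ≤
      (fpfInvolutions α).card / (Fintype.card α - 3) := by
    rw [le_div_iff₀' (by linarith)]
    exact card_filter_apply_eq_comp_le (hσ k) g
  have h1 := one_point k (σ k)
  have h2 := one_point (σ k) (σ (σ k))
  have h3 := one_point k (σ.symm k)
  have h4 := two_points σ
  have h5 := two_points σ.symm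
  calc _ ≤ _ := hcard'
    _ ≤ (fpfInvolutions α).card / (Fintype.card α - 1) +
        (fpfInvolutions α).card / (Fintype.card α - 1) +
        (fpfInvolutions α).card / (Fintype.card α - 1) +
        (fpfInvolutions α).card / (Fintype.card α - 3) +
        (fpfInvolutions α).card / (Fintype.card α - 3) := by gcongr
    _ = _ := by ring

lemma sum_agreements_mul {σ : Perm α} (hσ : ∀ i, σ i ≠ i) (f : ℕ → ℝ) :
    (Fintype.card α - 1) * ∑ π ∈ fpfInvolutions α, agreements σ π * f (agreements σ π) =
      ∑ k, ∑ π ∈ fpfInvolutions α, f (agreements σ (rematch k (σ k) π)) := by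
  rw [sum_congr rfl fun k _ => sum_rematch (hσ k) (fun π => f (agreements σ π)), ← mul_sum]
  congr 1
  simp_rw [sum_filter]
  rw [sum_comm]
  refine sum_congr rfl fun π _ => ?_
  rw [← sum_filter, sum_const, nsmul_eq_mul]
  rfl

/-- The number of agreements of a uniform fixed-point-free involution with `σ` almost satisfies
the characterizing identity of the Poisson distribution with mean one. -/
lemma abs_sum_stein_le {σ : Perm α} (hσ : ∀ i, σ i ≠ i) (hσ' : ∀ i, σ (σ i) ≠ i)
    (hα : 3 < Fintype.card α) {f : ℕ → ℝ} {B : ℝ} (hf : ∀ k, |f k| ≤ B) :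
    |∑ π ∈ fpfInvolutions α,
      (f (agreements σ π + 1) - agreements σ π * f (agreements σ π))| ≤
      29 * B / (Fintype.card α - 1) * (fpfInvolutions α).card := by
  have hα' : (4 : ℝ) ≤ Fintype.card α := by exact_mod_cast hα
  have hB : 0 ≤ B := (abs_nonneg _).trans (hf 0)
  have pointwise (k : α) :
      |∑ π ∈ fpfInvolutions α,
        (f (agreements σ π + 1) - f (agreements σ (rematch k (σ k) π)))| ≤
      2 * B * ((3 / (Fintype.card α - 1) + 2 / (Fintype.card α - 3)) *
        (fpfInvolutions α).card) := by
    refine (abs_sum_le_sum_abs _ _).trans (le_trans ?_ (mul_le_mul_of_nonneg_left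
      (card_filter_agreements_rematch_ne_le hσ hσ' hα k) (by positivity)))
    rw [mul_comm, ← nsmul_eq_mul, ← sum_const, sum_filter]
    refine sum_le_sum fun π _ => ?_
    split_ifs with h
    · refine (abs_sub _ _).trans ?_
      linarith [hf (agreements σ π + 1), hf (agreements σ (rematch k (σ k) π))]
    · rw [not_not.1 h, sub_self, abs_zero]
  have key : (Fintype.card α - 1) * ∑ π ∈ fpfInvolutions α,
      (f (agreements σ π + 1) - agreements σ π * f (agreements σ π)) =
      (∑ k, ∑ π ∈ fpfInvolutions α,
        (f (agreements σ π + 1) - f (agreements σ (rematch k (σ k) π)))) -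
        ∑ π ∈ fpfInvolutions α, f (agreements σ π + 1) := by
    simp_rw [sum_sub_distrib]
    rw [mul_sub, sum_agreements_mul hσ, sum_const, card_univ, nsmul_eq_mul]
    ring
  have h1 : |∑ k, ∑ π ∈ fpfInvolutions α,
      (f (agreements σ π + 1) - f (agreements σ (rematch k (σ k) π)))| ≤
      28 * B * (fpfInvolutions α).card := by
    refine (abs_sum_le_sum_abs _ _).trans ((sum_le_sum fun k _ => pointwise k).trans ?_)
    rw [sum_const, card_univ, nsmul_eq_mul]
    have e1 : (Fintype.card α : ℝ) / (Fintype.card α - 1) ≤ 2 := by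
      rw [div_le_iff₀ (by linarith)]; linarith
    have e2 : (Fintype.card α : ℝ) / (Fintype.card α - 3) ≤ 4 := by
      rw [div_le_iff₀ (by linarith)]; linarith
    calc _ = 2 * B * (fpfInvolutions α).card * (3 * (Fintype.card α / (Fintype.card α - 1)) +
          2 * (Fintype.card α / (Fintype.card α - 3))) := by ring
      _ ≤ 2 * B * (fpfInvolutions α).card * (3 * 2 + 2 * 4) := by gcongr
      _ = _ := by ring
  have h2 : |∑ π ∈ fpfInvolutions α, f (agreements σ π + 1)| ≤
      B * (fpfInvolutions α).card := by
    refine (abs_sum_le_sum_abs _ _).trans ((sum_le_sum fun π _ => hf _).trans ?_)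
    rw [sum_const, nsmul_eq_mul, mul_comm]
  rw [div_mul_eq_mul_div, le_div_iff₀' (by linarith), ← abs_of_pos (a := (Fintype.card α : ℝ) - 1)
    (by linarith), ← abs_mul, key]
  refine (abs_sub _ _).trans ?_
  linarith

end

/-- Bounded solutions of the Stein equation for the Poisson distribution with mean one. -/
lemma exists_poisson_stein_solution {h : ℕ → ℝ} (hb : ∀ k, |h k| ≤ 1)
    (h0 : HasSum (fun j => h j / (j)!) 0) :
    ∃ f : ℕ → ℝ, (∀ k : ℕ, f (k + 1) - k * f k = h k) ∧ ∀ k, |f k| ≤ Real.exp 1 := by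
  set F : ℕ → ℝ := fun k => ∑' i, ((k)! / (k + i)! : ℝ) * h (k + i) with hF
  have hexp : HasSum (fun i : ℕ => (1 / (i)! : ℝ)) (Real.exp 1) := by
    simpa [Real.exp_eq_exp_ℝ] using NormedSpace.expSeries_div_hasSum_exp (1 : ℝ)
  have bound (k i : ℕ) : ‖((k)! / (k + i)! : ℝ) * h (k + i)‖ ≤ 1 / (i)! := by
    rw [norm_mul, Real.norm_eq_abs, Real.norm_eq_abs, abs_of_nonneg (by positivity)]
    refine (mul_le_of_le_one_right (by positivity) (hb _)).trans ?_
    rw [div_le_div_iff₀ (by positivity) (by positivity), one_mul]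
    exact_mod_cast Nat.le_of_dvd (Nat.factorial_pos _)
      (Nat.factorial_mul_factorial_dvd_factorial_add k i)
  have hFb (k : ℕ) : |F k| ≤ Real.exp 1 := tsum_of_norm_bounded hexp (bound k)
  have hrec (k : ℕ) : F k = h k + F (k + 1) / (k + 1) := by
    rw [hF]
    simp only
    rw [(Summable.of_norm_bounded hexp.summable (bound k)).tsum_eq_zero_add, ← tsum_div_const]
    congr 1
    · rw [add_zero, div_self (by positivity), one_mul]
    · refine tsum_congr fun i => ?_
      rw [show k + (i + 1) = k + 1 + i by ring, Nat.factorial_succ k]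
      push_cast
      field_simp
  have hF0 : F 0 = 0 := by
    rw [hF, ← h0.tsum_eq]
    refine tsum_congr fun i => ?_
    rw [zero_add, Nat.factorial_zero]
    push_cast
    ring
  refine ⟨fun k => -F k / k, fun k => ?_, fun k => ?_⟩
  · have : (k : ℝ) * (-F k / k) = -F k := by
      rcases eq_or_ne k 0 with rfl | hk
      · simp [hF0]
      · field_simp
    rw [this, hrec k]
    push_cast
    ring
  · rw [abs_div, abs_neg, Nat.abs_cast]
    rcases Nat.eq_zero_or_pos k with rfl | hk
    · simpa using (Real.exp_pos 1).le
    · exact (div_le_self (abs_nonneg _) (by exact_mod_cast hk)).trans (hFb k)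

lemma hasSum_indicator_sub_poissonMeasure (A : Set ℕ) :
    HasSum (fun j : ℕ => (A.indicator 1 j - (poissonMeasure 1).real A) / (j)!) 0 := by
  have hint : Integrable (A.indicator (1 : ℕ → ℝ)) (poissonMeasure 1) :=
    (integrable_const 1).indicator (MeasurableSet.of_discrete)
  have hs := (hasSum_integral_poissonMeasure
    (hint.sub (integrable_const ((poissonMeasure 1).real A)))).mul_left (Real.exp 1)
  simp only [Pi.sub_apply] at hs
  rw [integral_sub hint (integrable_const _), integral_indicator_one MeasurableSet.of_discrete,
    integral_const, probReal_univ, one_smul, sub_self, mul_zero] at hs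
  refine hs.congr_fun fun j => ?_
  rw [NNReal.coe_one, one_pow, smul_eq_mul, ← mul_assoc, ← mul_div_assoc, mul_one, ← Real.exp_add,
    add_neg_cancel, Real.exp_zero]
  ring

lemma fpfInvolutions_fin_two_mul_nonempty (n : ℕ) : (fpfInvolutions (Fin (2 * n))).Nonempty := by
  refine ⟨Fin.revPerm, mem_fpfInvolutions.2 ⟨fun i => by simp, fun i hi => ?_⟩⟩
  rw [Fin.revPerm_apply, Fin.ext_iff, Fin.val_rev] at hi
  omega

lemma finRotate_apply_ne {N : ℕ} (hN : 2 ≤ N) (i : Fin N) : finRotate N i ≠ i := by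
  obtain ⟨m, rfl⟩ : ∃ m, N = m + 1 := ⟨N - 1, by omega⟩
  rw [ne_eq, Fin.ext_iff, coe_finRotate]
  split_ifs with h
  · rw [h, Fin.val_last]; omega
  · omega

lemma finRotate_finRotate_apply_ne {N : ℕ} (hN : 3 ≤ N) (i : Fin N) :
    finRotate N (finRotate N i) ≠ i := by
  obtain ⟨m, rfl⟩ : ∃ m, N = m + 1 := ⟨N - 1, by omega⟩
  have h1 := coe_finRotate i
  have h2 := coe_finRotate (finRotate (m + 1) i)
  simp only [Nat.succ_eq_add_one, Fin.ext_iff, Fin.val_last] at h1 h2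
  rw [ne_eq, Fin.ext_iff]
  split_ifs at h1 h2 <;> omega

lemma uniformCD_apply_toReal (n : ℕ) (A : Set ℕ) :
    ((uniformCD n) {π | simpleChords π ∈ A}).toReal =
      (∑ π ∈ fpfInvolutions (Fin (2 * n)),
        A.indicator (1 : ℕ → ℝ) (agreements (finRotate (2 * n)) π)) /
        (fpfInvolutions (Fin (2 * n))).card := by
  classical
  have hD : {π : Equiv.Perm (Fin (2 * n)) | IsChordDiagram π} =
      (fpfInvolutions (Fin (2 * n)) : Set (Equiv.Perm (Fin (2 * n)))) := by
    ext π
    rw [mem_coe, mem_fpfInvolutions]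
    rfl
  have hA : (fpfInvolutions (Fin (2 * n)) : Set (Equiv.Perm (Fin (2 * n)))) ∩
      {π | simpleChords π ∈ A} = ((fpfInvolutions (Fin (2 * n))).filter
        (fun π => agreements (finRotate (2 * n)) π ∈ A) : Finset _) := by
    ext π
    rw [mem_coe, mem_filter]
    rfl
  rw [uniformCD, uniformOn, hD, cond_apply MeasurableSpace.measurableSet_top, hA,
    Measure.count_apply_finset, Measure.count_apply_finset, ENNReal.toReal_mul,
    ENNReal.toReal_inv, ENNReal.toReal_natCast, ENNReal.toReal_natCast, mul_comm, ← div_eq_mul_inv,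
    card_filter]
  push_cast
  simp only [Set.indicator_apply, Pi.one_apply]

/-- Theorem 2: the total variation distance between the number of simple chords and a
Poisson(1) random variable is `O(1/n)`. -/
theorem simpleChords_poisson_tv_O :
    ∃ C : ℝ, 0 < C ∧ ∃ N : ℕ, ∀ n : ℕ, N ≤ n → ∀ A : Set ℕ,
      |((uniformCD n) {π | simpleChords π ∈ A}).toReal - ((poissonMeasure 1) A).toReal|
        ≤ C / n := by
  refine ⟨29 * Real.exp 1, by positivity, 2, fun n hn A => ?_⟩
  have hn' : (2 : ℝ) ≤ n := by exact_mod_cast hn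
  set p := (poissonMeasure 1).real A with hp
  have hp1 : p ≤ 1 := measureReal_le_one
  have hp0 : 0 ≤ p := measureReal_nonneg
  obtain ⟨f, hf, hfb⟩ := exists_poisson_stein_solution (h := fun j => A.indicator 1 j - p)
    (fun k => by
      by_cases hk : k ∈ A <;> simp only [hk, Set.indicator_of_mem, Set.indicator_of_notMem,
        not_false_eq_true, Pi.one_apply] <;> rw [abs_le] <;> constructor <;> linarith)
    (hasSum_indicator_sub_poissonMeasure A)
  have hM : (0 : ℝ) < (fpfInvolutions (Fin (2 * n))).card := by
    exact_mod_cast (fpfInvolutions_fin_two_mul_nonempty n).card_pos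
  have hs := abs_sum_stein_le (finRotate_apply_ne (N := 2 * n) (by omega))
    (finRotate_finRotate_apply_ne (by omega)) (by rw [Fintype.card_fin]; omega) hfb
  simp_rw [hf] at hs
  rw [sum_sub_distrib, sum_const, nsmul_eq_mul, Fintype.card_fin] at hs
  push_cast at hs
  rw [uniformCD_apply_toReal, ← measureReal_def, ← hp, div_sub' hM.ne', abs_div, abs_of_pos hM,
    div_le_iff₀ hM]
  refine hs.trans ?_
  gcongr
  linarith
end
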